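/- (Corollary 2) Consider the generalized Dueck DMBC with H(Z₀,Z₁) ≤ 1 and H(Z₀,Z₂) ≤ 1. If Z₁ — Z₀ — Z₂ does NOT form a Markov chain (equivalently, I(Z₁;Z₂|Z₀) > 0), then noiseless feedback strictly increases the capacity region: C_NoFB is a proper subset of C_NoiselessFB. In particular, there exists a pair (R₁,R₂) with (0,R₁,R₂) ∈ C_NoiselessFB but (0,R₁,R₂) ∉ C_NoFB. -/

import Mathlib

open scoped BigOperators Classical

noncomputable section

namespace BCFB

variable {Ω A B C : Type*}

/-- Probability of an event under a weight function on a finite sample space. -/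
def prOf [Fintype Ω] (w : Ω → ℝ) (E : Ω → Prop) : ℝ :=
  ∑ ω, if E ω then w ω else 0

/-- Distribution (pushforward) of a random variable. -/
def distOf [Fintype Ω] (w : Ω → ℝ) (X : Ω → A) : A → ℝ :=
  fun a => prOf w fun ω => X ω = a

/-- Shannon entropy (base 2) of a random variable. -/
def entOf [Fintype Ω] [Fintype A] (w : Ω → ℝ) (X : Ω → A) : ℝ :=
  -∑ a, distOf w X a * Real.logb 2 (distOf w X a)

/-- Mutual information (base 2). -/
def miOf [Fintype Ω] [Fintype A] [Fintype B] (w : Ω → ℝ) (X : Ω → A) (Y : Ω → B) : ℝ :=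
  entOf w X + entOf w Y - entOf w fun ω => (X ω, Y ω)

/-- Conditional mutual information I(X;Y|Z) (base 2). -/
def cmiOf [Fintype Ω] [Fintype A] [Fintype B] [Fintype C]
    (w : Ω → ℝ) (X : Ω → A) (Y : Ω → B) (Z : Ω → C) : ℝ :=
  entOf w (fun ω => (X ω, Z ω)) + entOf w (fun ω => (Y ω, Z ω))
    - entOf w (fun ω => (X ω, Y ω, Z ω)) - entOf w Z

/-- `w` is a probability mass function. -/
def IsPMF [Fintype Ω] (w : Ω → ℝ) : Prop := (∀ ω, 0 ≤ w ω) ∧ ∑ ω, w ω = 1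

/-- `k` is a transition kernel (each row a pmf). -/
def IsKernel {A B : Type*} [Fintype A] [Fintype B] (k : A → B → ℝ) : Prop :=
  ∀ a, IsPMF (k a)

/-- `X — Y — Z` forms a Markov chain (i.e. `X` and `Z` are conditionally
independent given `Y`). -/
def MarkovChain [Fintype Ω] (w : Ω → ℝ) (X : Ω → A) (Y : Ω → B) (Z : Ω → C) : Prop :=
  ∀ a b c,
    distOf w (fun ω => (X ω, Y ω, Z ω)) (a, b, c) * distOf w Y b
      = distOf w (fun ω => (X ω, Y ω)) (a, b) * distOf w (fun ω => (Z ω, Y ω)) (c, b)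

/-- `X` and `Y` are independent. -/
def IndepRV [Fintype Ω] (w : Ω → ℝ) (X : Ω → A) (Y : Ω → B) : Prop :=
  ∀ a b, distOf w (fun ω => (X ω, Y ω)) (a, b) = distOf w X a * distOf w Y b

/-- Number of messages of rate `R` and blocklength `n`: `⌊2^{nR}⌋`. -/
def msgCard (n : ℕ) (R : ℝ) : ℕ := ⌊(2 : ℝ) ^ ((n : ℝ) * R)⌋₊

/-- Binary entropy function. -/
def hb (u : ℝ) : ℝ := -(u * Real.logb 2 u) - (1 - u) * Real.logb 2 (1 - u)

/-- Empirical frequency of the letter `a` in the sequence `x`. -/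
def freqOf {A : Type*} {n : ℕ} (x : Fin n → A) (a : A) : ℝ :=
  ((Finset.univ.filter fun t => x t = a).card : ℝ) / n

/-- `ε`-typicality of a sequence w.r.t. a pmf `P`. -/
def Typical {A : Type*} (ε : ℝ) {n : ℕ} (P : A → ℝ) (x : Fin n → A) : Prop :=
  ∀ a, |freqOf x a - P a| ≤ ε * P a

section NoFB

variable {X Y1 Y2 : Type*} [Fintype X] [Fintype Y1] [Fintype Y2]

/-- Error probability of a blocklength-`n` no-feedback code over the DMBC `W`. -/
def errProbNoFB (W : X → Y1 × Y2 → ℝ) (n : ℕ) (R0 R1 R2 : ℝ)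
    (enc : Fin (msgCard n R0) × Fin (msgCard n R1) × Fin (msgCard n R2) → Fin n → X)
    (dec1 : (Fin n → Y1) → Fin (msgCard n R0) × Fin (msgCard n R1))
    (dec2 : (Fin n → Y2) → Fin (msgCard n R0) × Fin (msgCard n R2)) : ℝ :=
  (1 / ((msgCard n R0 : ℝ) * (msgCard n R1 : ℝ) * (msgCard n R2 : ℝ))) *
    ∑ m : Fin (msgCard n R0) × Fin (msgCard n R1) × Fin (msgCard n R2),
      ∑ y : Fin n → Y1 × Y2,
        (∏ t, W (enc m t) (y t)) *
          (if dec1 (fun t => (y t).1) ≠ (m.1, m.2.1) ∨ dec2 (fun t => (y t).2) ≠ (m.1, m.2.2)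
            then 1 else 0)

/-- Achievability of a rate triple over the DMBC `W` without feedback. -/
def AchievableNoFB (W : X → Y1 × Y2 → ℝ) (R0 R1 R2 : ℝ) : Prop :=
  0 ≤ R0 ∧ 0 ≤ R1 ∧ 0 ≤ R2 ∧
    ∃ enc : (n : ℕ) →
        Fin (msgCard n R0) × Fin (msgCard n R1) × Fin (msgCard n R2) → Fin n → X,
    ∃ dec1 : (n : ℕ) → (Fin n → Y1) → Fin (msgCard n R0) × Fin (msgCard n R1),
    ∃ dec2 : (n : ℕ) → (Fin n → Y2) → Fin (msgCard n R0) × Fin (msgCard n R2),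
      Filter.Tendsto (fun n => errProbNoFB W n R0 R1 R2 (enc n) (dec1 n) (dec2 n))
        Filter.atTop (nhds 0)

/-- The no-feedback capacity region. -/
def CNoFB (W : X → Y1 × Y2 → ℝ) : Set (ℝ × ℝ × ℝ) :=
  closure {r | AchievableNoFB W r.1 r.2.1 r.2.2}

end NoFB

section FB

variable {X Y1 Y2 Yt : Type*} [Fintype X] [Fintype Y1] [Fintype Y2] [Fintype Yt]

/-- Causality: the time-`t` channel input depends only on feedback symbols before time `t`. -/
def Causal {X Yt : Type*} (n : ℕ) {M : Type*} (enc : Fin n → M → (Fin n → Yt) → X) : Prop :=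
  ∀ (t : Fin n) (m : M) (fb fb' : Fin n → Yt),
    (∀ s : Fin n, (s : ℕ) < (t : ℕ) → fb s = fb' s) → enc t m fb = enc t m fb'

/-- Error probability of a blocklength-`n` feedback code over the DMBC with
generalized feedback `W`. -/
def errProbFB (W : X → Y1 × Y2 × Yt → ℝ) (n : ℕ) (R0 R1 R2 : ℝ)
    (enc : Fin n → Fin (msgCard n R0) × Fin (msgCard n R1) × Fin (msgCard n R2) →
      (Fin n → Yt) → X)
    (dec1 : (Fin n → Y1) → Fin (msgCard n R0) × Fin (msgCard n R1))
    (dec2 : (Fin n → Y2) → Fin (msgCard n R0) × Fin (msgCard n R2)) : ℝ :=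
  (1 / ((msgCard n R0 : ℝ) * (msgCard n R1 : ℝ) * (msgCard n R2 : ℝ))) *
    ∑ m : Fin (msgCard n R0) × Fin (msgCard n R1) × Fin (msgCard n R2),
      ∑ y : Fin n → Y1 × Y2 × Yt,
        (∏ t, W (enc t m fun s => (y s).2.2) (y t)) *
          (if dec1 (fun t => (y t).1) ≠ (m.1, m.2.1) ∨
              dec2 (fun t => (y t).2.1) ≠ (m.1, m.2.2)
            then 1 else 0)

/-- Achievability of a rate triple over the DMBC with generalized feedback `W`. -/
def AchievableFB (W : X → Y1 × Y2 × Yt → ℝ) (R0 R1 R2 : ℝ) : Prop :=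
  0 ≤ R0 ∧ 0 ≤ R1 ∧ 0 ≤ R2 ∧
    ∃ enc : (n : ℕ) → Fin n →
        Fin (msgCard n R0) × Fin (msgCard n R1) × Fin (msgCard n R2) → (Fin n → Yt) → X,
    ∃ dec1 : (n : ℕ) → (Fin n → Y1) → Fin (msgCard n R0) × Fin (msgCard n R1),
    ∃ dec2 : (n : ℕ) → (Fin n → Y2) → Fin (msgCard n R0) × Fin (msgCard n R2),
      (∀ n, Causal n (enc n)) ∧
      Filter.Tendsto (fun n => errProbFB W n R0 R1 R2 (enc n) (dec1 n) (dec2 n))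
        Filter.atTop (nhds 0)

/-- Capacity region of the DMBC with generalized feedback `W`. -/
def CGenFB (W : X → Y1 × Y2 × Yt → ℝ) : Set (ℝ × ℝ × ℝ) :=
  closure {r | AchievableFB W r.1 r.2.1 r.2.2}

end FB

/-- Extension of a DMBC to a generalized-feedback channel with noiseless feedback
`Ỹ = (Y₁, Y₂)`. -/
def noiselessExt {X Y1 Y2 : Type*} (W : X → Y1 × Y2 → ℝ) :
    X → Y1 × Y2 × (Y1 × Y2) → ℝ :=
  fun x y => if y.2.2 = (y.1, y.2.1) then W x (y.1, y.2.1) else 0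

/-- Capacity region of a DMBC with noiseless feedback. -/
def CNoiselessFB {X Y1 Y2 : Type*} [Fintype X] [Fintype Y1] [Fintype Y2]
    (W : X → Y1 × Y2 → ℝ) : Set (ℝ × ℝ × ℝ) :=
  CGenFB (noiselessExt W)

section Marton

variable {X Y1 Y2 : Type*} [Fintype X] [Fintype Y1] [Fintype Y2]

/-- The single-letter Marton constraints for the rate triple `(R0,R1,R2)`. -/
def MartonCond (W : X → Y1 × Y2 → ℝ) (R0 R1 R2 : ℝ) : Prop :=
  ∃ (k0 k1 k2 : ℕ) (p : Fin k0 × Fin k1 × Fin k2 → ℝ)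
    (f : Fin k0 × Fin k1 × Fin k2 → X), IsPMF p ∧
    (let w : (Fin k0 × Fin k1 × Fin k2) × Y1 × Y2 → ℝ := fun z => p z.1 * W (f z.1) z.2
     let U0 := fun z : (Fin k0 × Fin k1 × Fin k2) × Y1 × Y2 => z.1.1
     let U1 := fun z : (Fin k0 × Fin k1 × Fin k2) × Y1 × Y2 => z.1.2.1
     let U2 := fun z : (Fin k0 × Fin k1 × Fin k2) × Y1 × Y2 => z.1.2.2
     let Yr1 := fun z : (Fin k0 × Fin k1 × Fin k2) × Y1 × Y2 => z.2.1
     let Yr2 := fun z : (Fin k0 × Fin k1 × Fin k2) × Y1 × Y2 => z.2.2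
     R0 < min (miOf w U0 Yr1) (miOf w U0 Yr2) ∧
     R0 + R1 < miOf w (fun z => (U0 z, U1 z)) Yr1 ∧
     R0 + R2 < miOf w (fun z => (U0 z, U2 z)) Yr2 ∧
     R0 + R1 + R2 < cmiOf w U1 Yr1 U0 + cmiOf w U2 Yr2 U0
       + min (miOf w U0 Yr1) (miOf w U0 Yr2) - cmiOf w U1 U2 U0)

/-- Marton's achievable region for the DMBC `W` without feedback. -/
def MartonRegion (W : X → Y1 × Y2 → ℝ) : Set (ℝ × ℝ × ℝ) :=
  closure {r | 0 ≤ r.1 ∧ 0 ≤ r.2.1 ∧ 0 ≤ r.2.2 ∧ MartonCond W r.1 r.2.1 r.2.2}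

end Marton

end BCFB
namespace BCFB

/-- The generalized Dueck DMBC: input `x = (x₁, x₀, x₂)`, outputs
`y₁ = (x₁⊕z₁, x₀⊕z₀)` and `y₂ = (x₀⊕z₀, x₂⊕z₂)` where `(z₀,z₁,z₂) ~ PZ`. -/
def dueckW (PZ : Bool × Bool × Bool → ℝ) :
    Bool × Bool × Bool → (Bool × Bool) × Bool × Bool → ℝ :=
  fun x y =>
    if y.2.1 = y.1.2 then
      PZ (Bool.xor x.2.1 y.1.2, Bool.xor x.1 y.1.1, Bool.xor x.2.2 y.2.2)
    else 0

/-- The generalized Dueck DMBC with the noisy feedback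
`Ỹ = (Y₁₁⊕W₁, Y₁₀⊕W₀, Y₂₂⊕W₂)`, with feedback-noise law `Q` on `(W₀,W₁,W₂)`. -/
def dueckNoisyW (PZ : Bool × Bool × Bool → ℝ) (Q : Bool × Bool × Bool → ℝ) :
    Bool × Bool × Bool →
      (Bool × Bool) × (Bool × Bool) × (Bool × Bool × Bool) → ℝ :=
  fun x y =>
    dueckW PZ x (y.1, y.2.1) *
      Q (Bool.xor y.2.2.2.1 y.1.2, Bool.xor y.2.2.1 y.1.1, Bool.xor y.2.2.2.2 y.2.1.2)

end BCFB
namespace BCFB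

/-- A function with value `1` and negative derivative at `0` drops below `1`. -/
lemma exists_exp_moment_lt_one {α : Type*} [Fintype α] {p : α → ℝ} (hp : IsPMF p) {g : α → ℝ}
    (hg : ∑ a, p a * g a < 0) : ∃ l : ℝ, 0 < l ∧ ∑ a, p a * Real.exp (l * g a) < 1 := by
  have hd : HasDerivAt (fun l : ℝ => ∑ a, p a * Real.exp (l * g a)) (∑ a, p a * g a) 0 := by
    apply HasDerivAt.fun_sum
    intro a _
    have h := (((hasDerivAt_id (0 : ℝ)).mul_const (g a)).exp).const_mul (p a)
    simpa using h
  have hs := (hasDerivAt_iff_tendsto_slope.1 hd).eventually (gt_mem_nhds hg)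
  have hs' : ∀ᶠ l in nhdsWithin (0 : ℝ) (Set.Ioi 0),
      slope (fun l : ℝ => ∑ a, p a * Real.exp (l * g a)) 0 l < 0 :=
    hs.filter_mono (nhdsWithin_mono _ fun x hx => ne_of_gt hx)
  obtain ⟨l, hl, hl0⟩ := (hs'.and self_mem_nhdsWithin).exists
  refine ⟨l, hl0, ?_⟩
  rw [slope_def_field] at hl
  simp only [zero_mul, Real.exp_zero, mul_one, hp.2, sub_zero] at hl
  have hl0' : (0 : ℝ) < l := hl0
  have := (div_neg_iff.1 hl)
  rcases this with h | h <;> linarith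

/-- Chernoff bound for sums of i.i.d. letters over an index set `S`. -/
lemma exists_chernoff {α : Type*} [Fintype α] {p : α → ℝ} (hp : IsPMF p) {g : α → ℝ}
    (hg : ∑ a, p a * g a < 0) :
    ∃ ρ : ℝ, 0 ≤ ρ ∧ ρ < 1 ∧ ∀ (n : ℕ) (S : Finset (Fin n)),
      ∑ z : Fin n → α, (∏ t, p (z t)) * (if 0 ≤ ∑ t ∈ S, g (z t) then 1 else 0) ≤ ρ ^ S.card := by
  obtain ⟨l, hl, hl1⟩ := exists_exp_moment_lt_one hp hg
  refine ⟨_, Finset.sum_nonneg fun a _ => mul_nonneg (hp.1 a) (Real.exp_pos _).le, hl1, ?_⟩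
  intro n S
  calc _ ≤ ∑ z : Fin n → α, ∏ t, (p (z t) * if t ∈ S then Real.exp (l * g (z t)) else 1) := by
        apply Finset.sum_le_sum
        intro z _
        rw [Finset.prod_mul_distrib]
        apply mul_le_mul_of_nonneg_left _ (Finset.prod_nonneg fun t _ => hp.1 _)
        rw [Finset.prod_ite_mem, Finset.univ_inter, ← Real.exp_sum, ← Finset.mul_sum]
        split_ifs with h
        · exact Real.one_le_exp (mul_nonneg hl.le h)
        · exact (Real.exp_pos _).le
    _ = ∏ t : Fin n, ∑ a, (p a * if t ∈ S then Real.exp (l * g a) else 1) := by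
        rw [Finset.prod_univ_sum]; simp
    _ = ∏ t : Fin n, if t ∈ S then ∑ a, p a * Real.exp (l * g a) else 1 := by
        apply Finset.prod_congr rfl
        intro t _
        split_ifs <;> simp [hp.2]
    _ = _ := by rw [Finset.prod_ite_mem]; simp
    _ ≤ _ := le_rfl

/-- The cross entropy `-∑ p log₂ q`. -/
def crossEnt {α : Type*} [Fintype α] (p q : α → ℝ) : ℝ := -∑ a, p a * Real.logb 2 (q a)

lemma logb_prod_of_weight_ne_zero {α : Type*} {p q : α → ℝ} (hq : ∀ a, p a ≠ 0 → 0 < q a)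
    {n : ℕ} {z : Fin n → α} (hz : ∏ t, p (z t) ≠ 0) (S : Finset (Fin n)) :
    0 < ∏ t ∈ S, q (z t) ∧
      Real.logb 2 (∏ t ∈ S, q (z t)) = ∑ t ∈ S, Real.logb 2 (q (z t)) := by
  have h : ∀ t, 0 < q (z t) := fun t => hq _ (Finset.prod_ne_zero_iff.1 hz t (Finset.mem_univ _))
  exact ⟨Finset.prod_pos fun t _ => h t, Real.logb_prod _ _ fun t _ => (h t).ne'⟩

/-- The product of `q` along the letters is unlikely to be much smaller than its typical value. -/
lemma exists_prob_prod_lt_le {α : Type*} [Fintype α] {p q : α → ℝ} (hp : IsPMF p)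
    (hq : ∀ a, p a ≠ 0 → 0 < q a) {δ : ℝ} (hδ : 0 < δ) :
    ∃ ρ : ℝ, 0 ≤ ρ ∧ ρ < 1 ∧ ∀ (n : ℕ) (S : Finset (Fin n)),
      ∑ z : Fin n → α, (∏ t, p (z t)) *
        (if ∏ t ∈ S, q (z t) < 2 ^ (-(S.card * (crossEnt p q + δ))) then 1 else 0)
        ≤ ρ ^ S.card := by
  obtain ⟨ρ, h0, h1, h⟩ := exists_chernoff hp
    (g := fun a => -Real.logb 2 (q a) - (crossEnt p q + δ)) (by
      simp only [mul_sub, mul_neg, Finset.sum_sub_distrib, Finset.sum_neg_distrib,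
        ← Finset.sum_mul, hp.2]
      simp only [crossEnt]; linarith)
  refine ⟨ρ, h0, h1, fun n S => le_trans (Finset.sum_le_sum fun z _ => ?_) (h n S)⟩
  by_cases hz : ∏ t, p (z t) = 0
  · simp [hz]
  apply mul_le_mul_of_nonneg_left _ (Finset.prod_nonneg fun t _ => hp.1 _)
  obtain ⟨hpos, hlog⟩ := logb_prod_of_weight_ne_zero hq hz S
  split_ifs with h2 h3 <;> try norm_num
  apply h3
  have := (Real.logb_lt_iff_lt_rpow (b := 2) (by norm_num) hpos).2 h2
  rw [hlog] at this
  simp only [Finset.sum_sub_distrib, Finset.sum_neg_distrib, Finset.sum_const, nsmul_eq_mul]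
  linarith

/-- The product of `q` along the letters is unlikely to be much larger than its typical value. -/
lemma exists_prob_lt_prod_le {α : Type*} [Fintype α] {p q : α → ℝ} (hp : IsPMF p)
    (hq : ∀ a, p a ≠ 0 → 0 < q a) {δ : ℝ} (hδ : 0 < δ) :
    ∃ ρ : ℝ, 0 ≤ ρ ∧ ρ < 1 ∧ ∀ (n : ℕ) (S : Finset (Fin n)),
      ∑ z : Fin n → α, (∏ t, p (z t)) *
        (if 2 ^ (-(S.card * (crossEnt p q - δ))) < ∏ t ∈ S, q (z t) then 1 else 0)
        ≤ ρ ^ S.card := by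
  obtain ⟨ρ, h0, h1, h⟩ := exists_chernoff hp
    (g := fun a => Real.logb 2 (q a) + (crossEnt p q - δ)) (by
      simp only [mul_add, Finset.sum_add_distrib, ← Finset.sum_mul, hp.2]
      simp only [crossEnt]; linarith)
  refine ⟨ρ, h0, h1, fun n S => le_trans (Finset.sum_le_sum fun z _ => ?_) (h n S)⟩
  by_cases hz : ∏ t, p (z t) = 0
  · simp [hz]
  apply mul_le_mul_of_nonneg_left _ (Finset.prod_nonneg fun t _ => hp.1 _)
  obtain ⟨hpos, hlog⟩ := logb_prod_of_weight_ne_zero hq hz S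
  split_ifs with h2 h3 <;> try norm_num
  apply h3
  have := (Real.lt_logb_iff_rpow_lt (b := 2) (by norm_num) hpos).2 h2
  rw [hlog] at this
  simp only [Finset.sum_add_distrib, Finset.sum_const, nsmul_eq_mul]
  linarith

/-- A set of sequences on which a product of subprobabilities is at least `τ` has at most `1 / τ`
elements. -/
lemma card_mul_le_one_of_le_prod {α : Type*} [Fintype α] {n : ℕ} (q : Fin n → α → ℝ)
    (hq : ∀ t a, 0 ≤ q t a) (hs : ∀ t, ∑ a, q t a ≤ 1) (τ : ℝ) :
    ((Finset.univ.filter fun z : Fin n → α => τ ≤ ∏ t, q t (z t)).card : ℝ) * τ ≤ 1 := by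
  calc _ = ∑ z ∈ Finset.univ.filter fun z : Fin n → α => τ ≤ ∏ t, q t (z t), τ := by simp
    _ ≤ ∑ z ∈ Finset.univ.filter fun z : Fin n → α => τ ≤ ∏ t, q t (z t), ∏ t, q t (z t) :=
        Finset.sum_le_sum fun z hz => (Finset.mem_filter.1 hz).2
    _ ≤ ∑ z : Fin n → α, ∏ t, q t (z t) :=
        Finset.sum_le_sum_of_subset_of_nonneg (Finset.subset_univ _)
          fun z _ _ => Finset.prod_nonneg fun t _ => hq _ _
    _ = ∏ t, ∑ a, q t a := by rw [Finset.prod_univ_sum]; simp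
    _ ≤ 1 := Finset.prod_le_one (fun t _ => Finset.sum_nonneg fun a _ => hq _ _) fun t _ => hs t

section Marginals

variable {p : Bool × Bool × Bool → ℝ}

/-- Law of `Z₀`. -/
def mar0 (p : Bool × Bool × Bool → ℝ) (a : Bool) : ℝ := ∑ b, ∑ c, p (a, b, c)

/-- Law of `(Z₀, Z₁)`. -/
def mar01 (p : Bool × Bool × Bool → ℝ) (a b : Bool) : ℝ := ∑ c, p (a, b, c)

/-- Law of `(Z₀, Z₂)`. -/
def mar02 (p : Bool × Bool × Bool → ℝ) (a c : Bool) : ℝ := ∑ b, p (a, b, c)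

/-- The law with the same `(Z₀, Z₁)` and `(Z₀, Z₂)` marginals making `Z₁ — Z₀ — Z₂` Markov. -/
def markovLaw (p : Bool × Bool × Bool → ℝ) (z : Bool × Bool × Bool) : ℝ :=
  mar01 p z.1 z.2.1 * mar02 p z.1 z.2.2 / mar0 p z.1

lemma mar01_nonneg (hp : IsPMF p) (a b : Bool) : 0 ≤ mar01 p a b :=
  Finset.sum_nonneg fun _ _ => hp.1 _

lemma mar02_nonneg (hp : IsPMF p) (a c : Bool) : 0 ≤ mar02 p a c :=
  Finset.sum_nonneg fun _ _ => hp.1 _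

lemma sum_mar01 (a : Bool) : ∑ b, mar01 p a b = mar0 p a := rfl

lemma sum_mar02 (a : Bool) : ∑ c, mar02 p a c = mar0 p a := Finset.sum_comm

lemma mar0_nonneg (hp : IsPMF p) (a : Bool) : 0 ≤ mar0 p a :=
  Finset.sum_nonneg fun _ _ => mar01_nonneg hp a _

lemma sum_mar0 (hp : IsPMF p) : ∑ a, mar0 p a = 1 := by
  rw [← hp.2, Fintype.sum_prod_type]
  simp only [Fintype.sum_prod_type, mar0]

lemma le_mar01 (hp : IsPMF p) (a b c : Bool) : p (a, b, c) ≤ mar01 p a b :=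
  Finset.single_le_sum (f := fun c => p (a, b, c)) (fun _ _ => hp.1 _) (Finset.mem_univ c)

lemma le_mar02 (hp : IsPMF p) (a b c : Bool) : p (a, b, c) ≤ mar02 p a c :=
  Finset.single_le_sum (f := fun b => p (a, b, c)) (fun _ _ => hp.1 _) (Finset.mem_univ b)

lemma mar01_le_mar0 (hp : IsPMF p) (a b : Bool) : mar01 p a b ≤ mar0 p a :=
  Finset.single_le_sum (f := fun b => mar01 p a b) (fun _ _ => mar01_nonneg hp _ _)
    (Finset.mem_univ b)

lemma mar02_le_mar0 (hp : IsPMF p) (a c : Bool) : mar02 p a c ≤ mar0 p a := by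
  rw [← sum_mar02]
  exact Finset.single_le_sum (f := fun c => mar02 p a c) (fun _ _ => mar02_nonneg hp _ _)
    (Finset.mem_univ c)

lemma mar0_le_one (hp : IsPMF p) (a : Bool) : mar0 p a ≤ 1 := by
  rw [← sum_mar0 hp]
  exact Finset.single_le_sum (f := fun a => mar0 p a) (fun _ _ => mar0_nonneg hp _)
    (Finset.mem_univ a)

lemma pos_of_ne_zero (hp : IsPMF p) {z : Bool × Bool × Bool} (hz : p z ≠ 0) :
    0 < p z ∧ 0 < mar0 p z.1 ∧ 0 < mar01 p z.1 z.2.1 ∧ 0 < mar02 p z.1 z.2.2 := by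
  obtain ⟨a, b, c⟩ := z
  have h := lt_of_le_of_ne (hp.1 _) hz.symm
  have h1 := h.trans_le (le_mar01 hp a b c)
  exact ⟨h, h1.trans_le (mar01_le_mar0 hp a b), h1, h.trans_le (le_mar02 hp a b c)⟩

lemma markovLaw_mar01 (hp : IsPMF p) (a b : Bool) : ∑ c, markovLaw p (a, b, c) = mar01 p a b := by
  simp only [markovLaw, ← Finset.sum_div, ← Finset.mul_sum, sum_mar02]
  by_cases h : mar0 p a = 0
  · have := mar01_le_mar0 hp a b
    rw [h] at this ⊢
    have := le_antisymm this (mar01_nonneg hp a b)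
    simp [this]
  · field_simp

lemma markovLaw_mar02 (hp : IsPMF p) (a c : Bool) : ∑ b, markovLaw p (a, b, c) = mar02 p a c := by
  simp only [markovLaw, ← Finset.sum_div, ← Finset.sum_mul, sum_mar01]
  by_cases h : mar0 p a = 0
  · have := mar02_le_mar0 hp a c
    rw [h] at this ⊢
    have := le_antisymm this (mar02_nonneg hp a c)
    simp [this]
  · field_simp

lemma isPMF_markovLaw (hp : IsPMF p) : IsPMF (markovLaw p) := by
  refine ⟨fun z => div_nonneg (mul_nonneg (mar01_nonneg hp _ _) (mar02_nonneg hp _ _))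
    (mar0_nonneg hp _), ?_⟩
  rw [← sum_mar0 hp, Fintype.sum_prod_type]
  simp only [Fintype.sum_prod_type, markovLaw_mar01 hp, sum_mar01]

lemma sum_mul_mar01 (f : Bool → Bool → ℝ) :
    ∑ z, p z * f z.1 z.2.1 = ∑ a, ∑ b, mar01 p a b * f a b := by
  simp only [Fintype.sum_prod_type, mar01, Finset.sum_mul]

lemma sum_mul_mar02 (f : Bool → Bool → ℝ) :
    ∑ z, p z * f z.1 z.2.2 = ∑ a, ∑ c, mar02 p a c * f a c := by
  simp only [Fintype.sum_prod_type, mar02, Finset.sum_mul]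
  exact Finset.sum_congr rfl fun a _ => Finset.sum_comm

lemma entOf_mar01 : entOf p (fun z => (z.1, z.2.1)) = crossEnt p fun z => mar01 p z.1 z.2.1 := by
  have h : ∀ a b, distOf p (fun z : Bool × Bool × Bool => (z.1, z.2.1)) (a, b) = mar01 p a b := by
    intro a b
    cases a <;> cases b <;> simp [distOf, prOf, mar01, Fintype.sum_prod_type]
  simp only [entOf, crossEnt]
  rw [sum_mul_mar01 fun a b => Real.logb 2 (mar01 p a b), Fintype.sum_prod_type]
  simp only [h]

lemma entOf_mar02 : entOf p (fun z => (z.1, z.2.2)) = crossEnt p fun z => mar02 p z.1 z.2.2 := by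
  have h : ∀ a b, distOf p (fun z : Bool × Bool × Bool => (z.1, z.2.2)) (a, b) = mar02 p a b := by
    intro a b
    cases a <;> cases b <;> simp [distOf, prOf, mar02, Fintype.sum_prod_type]
  simp only [entOf, crossEnt]
  rw [sum_mul_mar02 fun a b => Real.logb 2 (mar02 p a b), Fintype.sum_prod_type]
  simp only [h]

lemma exists_ne_of_not_markovChain
    (h : ¬ MarkovChain p (fun z => z.2.1) (fun z => z.1) (fun z => z.2.2)) :
    ∃ z, p z * mar0 p z.1 ≠ mar01 p z.1 z.2.1 * mar02 p z.1 z.2.2 := by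
  by_contra! hc
  apply h
  intro b a c
  have := hc (a, b, c)
  revert this
  cases a <;> cases b <;> cases c <;>
    simp [distOf, prOf, mar01, mar02, mar0, Fintype.sum_prod_type]

lemma crossEnt_div {α : Type*} [Fintype α] {p q r : α → ℝ} (hq : ∀ a, p a ≠ 0 → 0 < q a)
    (hr : ∀ a, p a ≠ 0 → 0 < r a) :
    crossEnt p (fun a => q a / r a) = crossEnt p q - crossEnt p r := by
  simp only [crossEnt]
  rw [sub_neg_eq_add, ← neg_inj, neg_neg, neg_add, neg_neg, ← sub_eq_add_neg,
    ← Finset.sum_sub_distrib]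
  refine Finset.sum_congr rfl fun a _ => ?_
  by_cases h : p a = 0
  · simp [h]
  · rw [Real.logb_div (hq a h).ne' (hr a h).ne', mul_sub]

lemma crossEnt_le_crossEnt {α : Type*} [Fintype α] {p q r : α → ℝ} (hp : IsPMF p)
    (hq : ∀ a, p a ≠ 0 → 0 < q a) (h : ∀ a, q a ≤ r a) : crossEnt p r ≤ crossEnt p q := by
  simp only [crossEnt]
  refine neg_le_neg (Finset.sum_le_sum fun a _ => ?_)
  by_cases h0 : p a = 0
  · simp [h0]
  · exact mul_le_mul_of_nonneg_left
      (Real.logb_le_logb_of_le (by norm_num) (hq a h0) (h a)) (hp.1 a)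

/-- Strict Gibbs inequality. -/
lemma crossEnt_self_lt {α : Type*} [Fintype α] {p q : α → ℝ} (hp : IsPMF p) (hq : IsPMF q)
    (hpq : ∀ a, p a ≠ 0 → 0 < q a) (hne : ∃ a, p a ≠ q a) : crossEnt p p < crossEnt p q := by
  have hpp : ∀ a, p a ≠ 0 → 0 < p a := fun a h => lt_of_le_of_ne (hp.1 a) h.symm
  have key : ∑ a, p a * Real.log (q a / p a) < ∑ a, (q a - p a) := by
    obtain ⟨a₀, ha₀⟩ := hne
    refine Finset.sum_lt_sum (fun a _ => ?_) ⟨a₀, Finset.mem_univ _, ?_⟩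
    · by_cases h : p a = 0
      · simp [h, hq.1 a]
      · have := Real.log_le_sub_one_of_pos (div_pos (hpq a h) (hpp a h))
        have h2 := mul_le_mul_of_nonneg_left this (hp.1 a)
        have : p a * (q a / p a - 1) = q a - p a := by field_simp
        linarith
    · by_cases h : p a₀ = 0
      · have := lt_of_le_of_ne (hq.1 a₀) (h ▸ ha₀)
        simpa [h] using this
      · have := Real.log_lt_sub_one_of_pos (div_pos (hpq a₀ h) (hpp a₀ h)) (by
          rw [ne_eq, div_eq_one_iff_eq h]; exact ha₀.symm)
        have h2 := mul_lt_mul_of_pos_left this (hpp a₀ h)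
        have : p a₀ * (q a₀ / p a₀ - 1) = q a₀ - p a₀ := by field_simp
        linarith
  rw [Finset.sum_sub_distrib, hp.2, hq.2, sub_self] at key
  have h := crossEnt_div (p := p) (q := q) (r := p) hpq hpp
  have h3 : 0 < crossEnt p fun a => q a / p a := by
    simp only [crossEnt, Real.logb, ← mul_div_assoc, ← Finset.sum_div]
    rw [← neg_div]
    exact div_pos (by linarith) (Real.log_pos (by norm_num))
  linarith

lemma crossEnt_markovLaw (hp : IsPMF p) :
    crossEnt (markovLaw p) (markovLaw p) = crossEnt p (markovLaw p) := by
  have key : ∀ w : Bool × Bool × Bool → ℝ, (∀ z, w z ≠ 0 → markovLaw p z ≠ 0) →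
      crossEnt w (markovLaw p) = -(∑ z, w z * Real.logb 2 (mar01 p z.1 z.2.1)
        + ∑ z, w z * Real.logb 2 (mar02 p z.1 z.2.2)
        - ∑ z, w z * Real.logb 2 (mar0 p z.1)) := by
    intro w hw
    simp only [crossEnt, ← Finset.sum_add_distrib, ← Finset.sum_sub_distrib]
    rw [neg_inj]
    refine Finset.sum_congr rfl fun z _ => ?_
    by_cases h : w z = 0
    · simp [h]
    · have h1 := hw z h
      simp only [markovLaw, ne_eq, div_eq_zero_iff, mul_eq_zero, not_or] at h1 ⊢
      rw [Real.logb_div (mul_ne_zero h1.1.1 h1.1.2) h1.2, Real.logb_mul h1.1.1 h1.1.2]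
      ring
  rw [key _ fun _ h => h, key p fun z h => by
    obtain ⟨-, h0, h1, h2⟩ := pos_of_ne_zero hp h
    exact (div_pos (mul_pos h1 h2) h0).ne']
  have e1 : ∀ a b, mar01 (markovLaw p) a b = mar01 p a b := markovLaw_mar01 hp
  have e2 : ∀ a b, mar02 (markovLaw p) a b = mar02 p a b := markovLaw_mar02 hp
  rw [sum_mul_mar01 fun a b => Real.logb 2 (mar01 p a b),
    sum_mul_mar01 fun a b => Real.logb 2 (mar01 p a b),
    sum_mul_mar01 fun a _ => Real.logb 2 (mar0 p a),
    sum_mul_mar01 fun a _ => Real.logb 2 (mar0 p a),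
    sum_mul_mar02 fun a b => Real.logb 2 (mar02 p a b),
    sum_mul_mar02 fun a b => Real.logb 2 (mar02 p a b)]
  simp only [e1, e2]

/-- `H(Z₁ | Z₀)`-density kernel. -/
def ker1 (p : Bool × Bool × Bool → ℝ) (a b : Bool) : ℝ := mar01 p a b / mar0 p a

/-- Kernel of `Z₂` given `(Z₀, Z₁)`. -/
def ker2 (p : Bool × Bool × Bool → ℝ) (a b c : Bool) : ℝ := p (a, b, c) / mar01 p a b

lemma ker1_nonneg (hp : IsPMF p) (a b : Bool) : 0 ≤ ker1 p a b :=
  div_nonneg (mar01_nonneg hp _ _) (mar0_nonneg hp _)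

lemma ker2_nonneg (hp : IsPMF p) (a b c : Bool) : 0 ≤ ker2 p a b c :=
  div_nonneg (hp.1 _) (mar01_nonneg hp _ _)

lemma sum_ker1_le_one (a : Bool) : ∑ b, ker1 p a b ≤ 1 := by
  simp only [ker1, ← Finset.sum_div, sum_mar01]
  exact div_self_le_one _

lemma sum_ker2_le_one (a b : Bool) : ∑ c, ker2 p a b c ≤ 1 := by
  simp only [ker2, ← Finset.sum_div]
  exact div_self_le_one _

/-- Entropy bookkeeping for `H(Z₀)`, `H(Z₁|Z₀)`, `H(Z₂|Z₀,Z₁)` and the Markov law. -/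
lemma exists_entropy_gap (hp : IsPMF p)
    (h1 : entOf p (fun z => (z.1, z.2.1)) ≤ 1) (h2 : entOf p (fun z => (z.1, z.2.2)) ≤ 1)
    (hnm : ¬ MarkovChain p (fun z => z.2.1) (fun z => z.1) (fun z => z.2.2)) :
    ∃ I : ℝ, 0 < I ∧
      crossEnt (markovLaw p) (markovLaw p) = crossEnt p (fun z => mar0 p z.1)
        + crossEnt p (fun z => ker1 p z.1 z.2.1) + crossEnt p (fun z => ker2 p z.1 z.2.1 z.2.2) + I ∧
      0 ≤ crossEnt p (fun z => mar0 p z.1) ∧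
      crossEnt p (fun z => mar0 p z.1) + crossEnt p (fun z => ker1 p z.1 z.2.1) ≤ 1 ∧
      I ≤ crossEnt p (fun z => ker1 p z.1 z.2.1) ∧
      crossEnt p (fun z => ker2 p z.1 z.2.1 z.2.2) ≤ 1 - I := by
  rw [entOf_mar01] at h1
  rw [entOf_mar02] at h2
  have P := fun z (h : p z ≠ 0) => pos_of_ne_zero hp (z := z) h
  have e1 : crossEnt p (fun z => ker1 p z.1 z.2.1) = _ :=
    crossEnt_div (p := p) (q := fun z => mar01 p z.1 z.2.1) (r := fun z => mar0 p z.1)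
      (fun z h => (P z h).2.2.1) (fun z h => (P z h).2.1)
  have e2 : crossEnt p (fun z => ker2 p z.1 z.2.1 z.2.2) = _ :=
    crossEnt_div (p := p) (q := p) (r := fun z => mar01 p z.1 z.2.1)
      (fun z h => (P z h).1) (fun z h => (P z h).2.2.1)
  have em : crossEnt p (markovLaw p) = crossEnt p (fun z => mar01 p z.1 z.2.1)
      + crossEnt p (fun z => mar02 p z.1 z.2.2) - crossEnt p (fun z => mar0 p z.1) := by
    have h : crossEnt p (fun z => mar01 p z.1 z.2.1 / (mar0 p z.1 / mar02 p z.1 z.2.2)) = _ :=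
      crossEnt_div (p := p) (q := fun z => mar01 p z.1 z.2.1)
      (r := fun z => mar0 p z.1 / mar02 p z.1 z.2.2) (fun z h => (P z h).2.2.1)
      (fun z h => div_pos (P z h).2.1 (P z h).2.2.2)
    have h' : crossEnt p (fun z => mar0 p z.1 / mar02 p z.1 z.2.2) = _ :=
      crossEnt_div (p := p) (q := fun z => mar0 p z.1)
      (r := fun z => mar02 p z.1 z.2.2) (fun z h => (P z h).2.1) (fun z h => (P z h).2.2.2)
    have : markovLaw p = fun z => mar01 p z.1 z.2.1 / (mar0 p z.1 / mar02 p z.1 z.2.2) := by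
      funext z
      rw [markovLaw, div_div_eq_mul_div]
    rw [this, h, h']
    ring
  have hgap : crossEnt p p < crossEnt p (markovLaw p) := by
    refine crossEnt_self_lt hp (isPMF_markovLaw hp) (fun z h => ?_) ?_
    · obtain ⟨-, h0, h1, h2⟩ := P z h
      exact div_pos (mul_pos h1 h2) h0
    · obtain ⟨z, hz⟩ := exists_ne_of_not_markovChain hnm
      refine ⟨z, fun he => hz ?_⟩
      rw [he, markovLaw]
      by_cases h0 : mar0 p z.1 = 0
      · have := mar01_le_mar0 hp z.1 z.2.1
        rw [h0] at this
        rw [le_antisymm this (mar01_nonneg hp _ _)]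
        simp
      · field_simp
  have h0 : 0 ≤ crossEnt p (fun z => mar0 p z.1) := by
    have := crossEnt_le_crossEnt hp (q := fun z => mar0 p z.1) (r := fun _ => 1)
      (fun z h => (P z h).2.1) (fun z => mar0_le_one hp _)
    simpa [crossEnt] using this
  have h02 : crossEnt p (fun z => mar02 p z.1 z.2.2) ≤ crossEnt p p :=
    crossEnt_le_crossEnt hp (fun z h => (P z h).1) fun z => le_mar02 hp _ _ _
  refine ⟨crossEnt p (markovLaw p) - crossEnt p p, by linarith, ?_, h0, ?_, ?_, ?_⟩
  · rw [crossEnt_markovLaw hp]; linarith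
  all_goals linarith

end Marginals

/-- The three received bits, ordered `(common, first, second)`, as a channel output pair. -/
def outPair (v : Bool × Bool × Bool) : (Bool × Bool) × Bool × Bool := ((v.2.1, v.1), (v.1, v.2.2))

/-- The noise triple explaining the received bits `v` for the input `x`. -/
def noiseOf (x v : Bool × Bool × Bool) : Bool × Bool × Bool :=
  (Bool.xor x.2.1 v.1, Bool.xor x.1 v.2.1, Bool.xor x.2.2 v.2.2)

lemma dueckW_outPair (PZ : Bool × Bool × Bool → ℝ) (x v : Bool × Bool × Bool) :
    dueckW PZ x (outPair v) = PZ (noiseOf x v) := by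
  simp [dueckW, outPair, noiseOf]

lemma outPair_injective : Function.Injective outPair := by
  rintro ⟨a, b, c⟩ ⟨a', b', c'⟩ h
  simp only [outPair, Prod.mk.injEq] at h ⊢
  tauto

lemma dueckW_eq_zero {PZ : Bool × Bool × Bool → ℝ} {x : Bool × Bool × Bool}
    {y : (Bool × Bool) × Bool × Bool} (hy : y ∉ Set.range outPair) : dueckW PZ x y = 0 := by
  refine if_neg fun h => hy ⟨(y.1.2, y.1.1, y.2.2), ?_⟩
  obtain ⟨⟨a, b⟩, c, d⟩ := y
  simp only at h
  simp [outPair, h]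

lemma noiseOf_injective (x : Bool × Bool × Bool) : Function.Injective (noiseOf x) := by
  rintro ⟨a, b, c⟩ ⟨a', b', c'⟩ h
  simpa [noiseOf] using h

/-- Sums against a product law supported on the letterwise range of an injection. -/
lemma sum_prod_mul_comp {α β : Type*} [Fintype α] [Fintype β] {n : ℕ} {o : α → β}
    (ho : Function.Injective o) (w : (Fin n → β) → Fin n → ℝ)
    (hw : ∀ y t, y t ∉ Set.range o → w y t = 0) (f : (Fin n → β) → ℝ) :
    ∑ y, (∏ t, w y t) * f y = ∑ v : Fin n → α, (∏ t, w (o ∘ v) t) * f (o ∘ v) := by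
  symm
  refine Finset.sum_of_injOn (fun v => o ∘ v) (ho.comp_left.injOn) (fun _ _ => by simp)
    (fun y _ hy => ?_) fun _ _ => rfl
  have : ∃ t, y t ∉ Set.range o := by
    by_contra! h
    choose v hv using h
    exact hy ⟨v, by simp, funext hv⟩
  obtain ⟨t, ht⟩ := this
  rw [Finset.prod_eq_zero (Finset.mem_univ t) (hw y t ht), zero_mul]

lemma errProbNoFB_eq_errProbFB {X Y1 Y2 : Type*} [Fintype Y1] [Fintype Y2]
    (W : X → Y1 × Y2 → ℝ) (n : ℕ) (R0 R1 R2 : ℝ)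
    (enc : Fin (msgCard n R0) × Fin (msgCard n R1) × Fin (msgCard n R2) → Fin n → X)
    (dec1 : (Fin n → Y1) → Fin (msgCard n R0) × Fin (msgCard n R1))
    (dec2 : (Fin n → Y2) → Fin (msgCard n R0) × Fin (msgCard n R2)) :
    errProbFB (noiselessExt W) n R0 R1 R2 (fun t m _ => enc m t) dec1 dec2
      = errProbNoFB W n R0 R1 R2 enc dec1 dec2 := by
  simp only [errProbFB, errProbNoFB]
  congr 1
  refine Finset.sum_congr rfl fun m _ => ?_
  rw [sum_prod_mul_comp (α := Y1 × Y2) (o := fun y => (y.1, y.2, y))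
    (fun a b h => by simpa using congrArg (fun q => q.2.2) h)
    (fun y t => noiselessExt W (enc m t) (y t))
    (fun y t h => if_neg fun h' => h ⟨(y t).2.2, by rw [h']; exact Prod.ext rfl (Prod.ext rfl h'.symm)⟩)]
  simp [noiselessExt]

lemma CNoFB_subset_CNoiselessFB {X Y1 Y2 : Type*} [Fintype X] [Fintype Y1] [Fintype Y2]
    (W : X → Y1 × Y2 → ℝ) : CNoFB W ⊆ CNoiselessFB W := by
  refine closure_mono ?_
  rintro r ⟨h0, h1, h2, enc, dec1, dec2, h⟩
  refine ⟨h0, h1, h2, fun n t m _ => enc n m t, dec1, dec2, fun n t m _ _ _ => rfl, ?_⟩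
  simpa only [errProbNoFB_eq_errProbFB] using h

section Converse

variable {X Y1 Y2 : Type*} [Fintype Y1] [Fintype Y2]

lemma sum_prod_mul_fst {n : ℕ} (f : Fin n → Y1 × Y2 → ℝ) (g : (Fin n → Y1) → ℝ) :
    ∑ y : Fin n → Y1 × Y2, (∏ t, f t (y t)) * g (fun t => (y t).1)
      = ∑ u : Fin n → Y1, (∏ t, ∑ b, f t (u t, b)) * g u := by
  rw [← (Equiv.arrowProdEquivProdArrow (Fin n) (fun _ => Y1) (fun _ => Y2)).symm.sum_comp,
    Fintype.sum_prod_type]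
  refine Finset.sum_congr rfl fun u _ => ?_
  rw [Finset.prod_univ_sum, Finset.sum_mul]
  simp [Equiv.arrowProdEquivProdArrow]

lemma sum_prod_mul_snd {n : ℕ} (f : Fin n → Y1 × Y2 → ℝ) (g : (Fin n → Y2) → ℝ) :
    ∑ y : Fin n → Y1 × Y2, (∏ t, f t (y t)) * g (fun t => (y t).2)
      = ∑ u : Fin n → Y2, (∏ t, ∑ a, f t (a, u t)) * g u := by
  rw [← (Equiv.arrowProdEquivProdArrow (Fin n) (fun _ => Y1) (fun _ => Y2)).symm.sum_comp,
    Fintype.sum_prod_type_right]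
  refine Finset.sum_congr rfl fun u _ => ?_
  rw [Finset.prod_univ_sum, Finset.sum_mul]
  simp [Equiv.arrowProdEquivProdArrow]

/-- Without feedback, channels with the same marginals have comparable error probabilities. -/
lemma errProbNoFB_le_two_mul {W V : X → Y1 × Y2 → ℝ} (hW : ∀ x y, 0 ≤ W x y)
    (hV : ∀ x y, 0 ≤ V x y) (h1 : ∀ x a, ∑ b, V x (a, b) = ∑ b, W x (a, b))
    (h2 : ∀ x b, ∑ a, V x (a, b) = ∑ a, W x (a, b)) (n : ℕ) (R0 R1 R2 : ℝ)
    (enc : Fin (msgCard n R0) × Fin (msgCard n R1) × Fin (msgCard n R2) → Fin n → X)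
    (dec1 : (Fin n → Y1) → Fin (msgCard n R0) × Fin (msgCard n R1))
    (dec2 : (Fin n → Y2) → Fin (msgCard n R0) × Fin (msgCard n R2)) :
    errProbNoFB V n R0 R1 R2 enc dec1 dec2 ≤ 2 * errProbNoFB W n R0 R1 R2 enc dec1 dec2 := by
  simp only [errProbNoFB]
  rw [mul_left_comm]
  refine mul_le_mul_of_nonneg_left ?_ (by positivity)
  rw [Finset.mul_sum]
  refine Finset.sum_le_sum fun m _ => ?_
  have e1 := sum_prod_mul_fst (fun t => V (enc m t))
    (fun u => if dec1 u ≠ (m.1, m.2.1) then (1 : ℝ) else 0)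
  have e2 := sum_prod_mul_snd (fun t => V (enc m t))
    (fun u => if dec2 u ≠ (m.1, m.2.2) then (1 : ℝ) else 0)
  simp only [h1] at e1
  simp only [h2] at e2
  rw [← sum_prod_mul_fst (fun t => W (enc m t))] at e1
  rw [← sum_prod_mul_snd (fun t => W (enc m t))] at e2
  calc _ ≤ ∑ y : Fin n → Y1 × Y2, ((∏ t, V (enc m t) (y t)) *
            (if dec1 (fun t => (y t).1) ≠ (m.1, m.2.1) then 1 else 0) +
          (∏ t, V (enc m t) (y t)) *
            (if dec2 (fun t => (y t).2) ≠ (m.1, m.2.2) then 1 else 0)) := by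
        refine Finset.sum_le_sum fun y _ => ?_
        rw [← mul_add]
        refine mul_le_mul_of_nonneg_left ?_ (Finset.prod_nonneg fun t _ => hV _ _)
        split_ifs <;> first | (exfalso; tauto) | norm_num
    _ = _ := by rw [Finset.sum_add_distrib, e1, e2]
    _ ≤ _ := by
        rw [two_mul]
        refine add_le_add (Finset.sum_le_sum fun y _ => ?_) (Finset.sum_le_sum fun y _ => ?_)
        all_goals
          refine mul_le_mul_of_nonneg_left ?_ (Finset.prod_nonneg fun t _ => hW _ _)
          split_ifs <;> first | (exfalso; tauto) | norm_num

end Converse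

lemma dueckW_nonneg {p : Bool × Bool × Bool → ℝ} (hp : IsPMF p) (x : Bool × Bool × Bool)
    (y : (Bool × Bool) × Bool × Bool) : 0 ≤ dueckW p x y := by
  unfold dueckW
  split_ifs
  · exact hp.1 _
  · exact le_rfl

lemma sum_dueckW_fst (p : Bool × Bool × Bool → ℝ) (x : Bool × Bool × Bool) (a : Bool × Bool) :
    ∑ b, dueckW p x (a, b) = mar01 p (Bool.xor x.2.1 a.2) (Bool.xor x.1 a.1) := by
  obtain ⟨a, c⟩ := a
  obtain ⟨x1, x0, x2⟩ := x
  cases c <;> cases x2 <;> simp [dueckW, mar01, Fintype.sum_prod_type, add_comm]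

lemma sum_dueckW_snd (p : Bool × Bool × Bool → ℝ) (x : Bool × Bool × Bool) (b : Bool × Bool) :
    ∑ a, dueckW p x (a, b) = mar02 p (Bool.xor x.2.1 b.1) (Bool.xor x.2.2 b.2) := by
  obtain ⟨c, d⟩ := b
  obtain ⟨x1, x0, x2⟩ := x
  cases c <;> cases x1 <;> simp [dueckW, mar02, Fintype.sum_prod_type, add_comm]

lemma errProbNoFB_markovLaw_le {p : Bool × Bool × Bool → ℝ} (hp : IsPMF p) (n : ℕ)
    (R0 R1 R2 : ℝ)
    (enc : Fin (msgCard n R0) × Fin (msgCard n R1) × Fin (msgCard n R2) → Fin n →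
      Bool × Bool × Bool)
    (dec1 : (Fin n → Bool × Bool) → Fin (msgCard n R0) × Fin (msgCard n R1))
    (dec2 : (Fin n → Bool × Bool) → Fin (msgCard n R0) × Fin (msgCard n R2)) :
    errProbNoFB (dueckW (markovLaw p)) n R0 R1 R2 enc dec1 dec2
      ≤ 2 * errProbNoFB (dueckW p) n R0 R1 R2 enc dec1 dec2 := by
  refine errProbNoFB_le_two_mul (dueckW_nonneg hp) (dueckW_nonneg (isPMF_markovLaw hp))
    (fun x a => ?_) (fun x b => ?_) n R0 R1 R2 enc dec1 dec2
  · rw [sum_dueckW_fst, sum_dueckW_fst]; exact markovLaw_mar01 hp _ _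
  · rw [sum_dueckW_snd, sum_dueckW_snd]; exact markovLaw_mar02 hp _ _

lemma half_rpow_le_msgCard {n : ℕ} {R : ℝ} (hR : 0 ≤ R) :
    (2 : ℝ) ^ ((n : ℝ) * R) / 2 ≤ msgCard n R := by
  have h1 : (1 : ℝ) ≤ (2 : ℝ) ^ ((n : ℝ) * R) :=
    Real.one_le_rpow (by norm_num) (by positivity)
  have h2 := Nat.lt_floor_add_one ((2 : ℝ) ^ ((n : ℝ) * R))
  have h3 : (1 : ℝ) ≤ (msgCard n R : ℝ) := by
    exact_mod_cast Nat.le_floor (by simpa using h1)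
  unfold msgCard at *
  linarith

lemma noise_bijective {n : ℕ} (x : Fin n → Bool × Bool × Bool) :
    Function.Bijective fun (v : Fin n → Bool × Bool × Bool) t => noiseOf (x t) (v t) :=
  Finite.injective_iff_bijective.1 fun _ _ h =>
    funext fun t => noiseOf_injective (x t) (congrFun h t)

lemma sum_prod_law {α : Type*} [Fintype α] {p : α → ℝ} (hp : IsPMF p) (n : ℕ) :
    ∑ z : Fin n → α, ∏ t, p (z t) = 1 := by
  have h := Finset.prod_univ_sum (fun _ : Fin n => (Finset.univ : Finset α)) fun _ a => p a
  simp only [hp.2, Finset.prod_const_one, Fintype.piFinset_univ] at h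
  exact h.symm

/-- A sphere-packing bound on the success probability over the Dueck channel. -/
lemma one_sub_errProbNoFB_le {p : Bool × Bool × Bool → ℝ} (hp : IsPMF p) (n : ℕ)
    {R0 R1 R2 : ℝ} (hM : (0 : ℝ) < msgCard n R0 * msgCard n R1 * msgCard n R2)
    (enc : Fin (msgCard n R0) × Fin (msgCard n R1) × Fin (msgCard n R2) → Fin n →
      Bool × Bool × Bool)
    (dec1 : (Fin n → Bool × Bool) → Fin (msgCard n R0) × Fin (msgCard n R1))
    (dec2 : (Fin n → Bool × Bool) → Fin (msgCard n R0) × Fin (msgCard n R2))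
    {τ : ℝ} (hτ : 0 ≤ τ) :
    1 - errProbNoFB (dueckW p) n R0 R1 R2 enc dec1 dec2 ≤
      (∑ z : Fin n → Bool × Bool × Bool,
        (∏ t, p (z t)) * (if τ < ∏ t, p (z t) then 1 else 0))
      + 8 ^ n * τ / (msgCard n R0 * msgCard n R1 * msgCard n R2) := by
  set tail := ∑ z : Fin n → Bool × Bool × Bool,
    (∏ t, p (z t)) * (if τ < ∏ t, p (z t) then 1 else 0) with htail
  let corr (m : Fin (msgCard n R0) × Fin (msgCard n R1) × Fin (msgCard n R2))
    (v : Fin n → Bool × Bool × Bool) : Prop :=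
    dec1 (fun t => (outPair (v t)).1) = (m.1, m.2.1) ∧
      dec2 (fun t => (outPair (v t)).2) = (m.1, m.2.2)
  have hper : ∀ m, 1 - ∑ y : Fin n → (Bool × Bool) × Bool × Bool,
      (∏ t, dueckW p (enc m t) (y t)) *
        (if dec1 (fun t => (y t).1) ≠ (m.1, m.2.1) ∨ dec2 (fun t => (y t).2) ≠ (m.1, m.2.2)
          then 1 else 0) ≤ τ * (∑ v, if corr m v then 1 else 0) + tail := by
    intro m
    rw [sum_prod_mul_comp outPair_injective (fun y t => dueckW p (enc m t) (y t))
      fun y t h => dueckW_eq_zero h]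
    simp only [Function.comp_apply, dueckW_outPair]
    have hbij := noise_bijective (enc m)
    have h1 : ∑ v : Fin n → Bool × Bool × Bool, ∏ t, p (noiseOf (enc m t) (v t)) = 1 := by
      rw [← sum_prod_law hp n]
      exact hbij.sum_comp fun z => ∏ t, p (z t)
    have h2 : ∑ v : Fin n → Bool × Bool × Bool, (∏ t, p (noiseOf (enc m t) (v t))) *
        (if τ < ∏ t, p (noiseOf (enc m t) (v t)) then 1 else 0) = tail :=
      hbij.sum_comp fun z => (∏ t, p (z t)) * (if τ < ∏ t, p (z t) then 1 else 0)
    refine le_of_eq_of_le (congrArg (· - _) h1.symm) ?_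
    rw [← h2, Finset.mul_sum, ← Finset.sum_sub_distrib, ← Finset.sum_add_distrib]
    refine Finset.sum_le_sum fun v _ => ?_
    have hnn : 0 ≤ ∏ t, p (noiseOf (enc m t) (v t)) := Finset.prod_nonneg fun t _ => hp.1 _
    by_cases hc : corr m v
    · have hc' : ¬ (dec1 (fun t => (outPair (v t)).1) ≠ (m.1, m.2.1) ∨
          dec2 (fun t => (outPair (v t)).2) ≠ (m.1, m.2.2)) := by
        simp only [corr] at hc
        tauto
      rw [if_pos hc, if_neg hc']
      split_ifs with h <;> linarith
    · have hc' : (dec1 (fun t => (outPair (v t)).1) ≠ (m.1, m.2.1) ∨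
          dec2 (fun t => (outPair (v t)).2) ≠ (m.1, m.2.2)) := by
        simp only [corr] at hc
        tauto
      rw [if_neg hc, if_pos hc']
      split_ifs with h <;> linarith
  have hcorr : ∑ m, ∑ v, (if corr m v then (1 : ℝ) else 0) ≤ 8 ^ n := by
    rw [Finset.sum_comm]
    calc _ ≤ ∑ v : Fin n → Bool × Bool × Bool, (1 : ℝ) := by
          refine Finset.sum_le_sum fun v _ => ?_
          rw [Finset.sum_boole]
          norm_cast
          refine Finset.card_le_one.2 fun a ha b hb => ?_
          obtain ⟨h1, h2⟩ := (Finset.mem_filter.1 ha).2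
          obtain ⟨h3, h4⟩ := (Finset.mem_filter.1 hb).2
          rw [h1] at h3
          rw [h2] at h4
          obtain ⟨a0, a1, a2⟩ := a
          obtain ⟨b0, b1, b2⟩ := b
          simp only [Prod.mk.injEq] at h3 h4 ⊢
          exact ⟨h3.1, h3.2, h4.2⟩
      _ = 8 ^ n := by simp
  have hsum := Finset.sum_le_sum fun m (_ : m ∈ Finset.univ) => hper m
  rw [Finset.sum_sub_distrib, Finset.sum_add_distrib, ← Finset.mul_sum] at hsum
  simp only [Finset.sum_const, Finset.card_univ, Fintype.card_prod, Fintype.card_fin,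
    nsmul_eq_mul, Nat.cast_mul, mul_one] at hsum
  rw [← mul_assoc] at hsum
  have h3 := mul_le_mul_of_nonneg_left hcorr hτ
  simp only [errProbNoFB]
  rw [← mul_le_mul_iff_right₀ hM, mul_sub, mul_add, ← mul_assoc, mul_one_div_cancel hM.ne',
    mul_div_cancel₀ _ hM.ne', one_mul]
  linarith

/-- Sum-rate converse without feedback. -/
lemma AchievableNoFB.sum_rate_le {p : Bool × Bool × Bool → ℝ} (hp : IsPMF p) {R0 R1 R2 : ℝ}
    (h : AchievableNoFB (dueckW p) R0 R1 R2) :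
    R0 + R1 + R2 ≤ 3 - crossEnt (markovLaw p) (markovLaw p) := by
  obtain ⟨hR0, hR1, hR2, enc, dec1, dec2, hlim⟩ := h
  by_contra! hlt
  set Ht := crossEnt (markovLaw p) (markovLaw p)
  have hπ := isPMF_markovLaw hp
  obtain ⟨δ, hδ, hδ'⟩ : ∃ δ : ℝ, 0 < δ ∧ 3 - Ht + 2 * δ = R0 + R1 + R2 :=
    ⟨(R0 + R1 + R2 - (3 - Ht)) / 2, by linarith, by ring⟩
  obtain ⟨ρ, hρ0, hρ1, hρ⟩ := exists_prob_lt_prod_le hπ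
    (q := markovLaw p) (fun a ha => lt_of_le_of_ne (hπ.1 a) ha.symm) hδ
  have hbound : ∀ n : ℕ, 1 - 2 * errProbNoFB (dueckW p) n R0 R1 R2 (enc n) (dec1 n) (dec2 n)
      ≤ ρ ^ n + 8 * ((2 : ℝ) ^ (-δ)) ^ n := by
    intro n
    have m0 := half_rpow_le_msgCard (n := n) hR0
    have m1 := half_rpow_le_msgCard (n := n) hR1
    have m2 := half_rpow_le_msgCard (n := n) hR2
    have hMlow : (2 : ℝ) ^ (n * (R0 + R1 + R2)) / 8
        ≤ msgCard n R0 * msgCard n R1 * msgCard n R2 := by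
      have := mul_le_mul (mul_le_mul m0 m1 (by positivity) (by positivity)) m2 (by positivity)
        (by positivity)
      refine le_trans (le_of_eq ?_) this
      rw [mul_add, mul_add, Real.rpow_add (by norm_num), Real.rpow_add (by norm_num)]
      ring
    have hM : (0 : ℝ) < msgCard n R0 * msgCard n R1 * msgCard n R2 :=
      lt_of_lt_of_le (by positivity) hMlow
    have hs := one_sub_errProbNoFB_le hπ n hM (enc n) (dec1 n) (dec2 n)
      (τ := 2 ^ (-(n * (Ht - δ)))) (by positivity)
    have ht := hρ n Finset.univ
    rw [Finset.card_univ, Fintype.card_fin] at ht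
    have hm := errProbNoFB_markovLaw_le hp n R0 R1 R2 (enc n) (dec1 n) (dec2 n)
    have hq : 8 ^ n * (2 : ℝ) ^ (-(n * (Ht - δ))) / (msgCard n R0 * msgCard n R1 * msgCard n R2)
        ≤ 8 * ((2 : ℝ) ^ (-δ)) ^ n := by
      rw [div_le_iff₀ hM]
      refine le_trans (le_of_eq ?_) (mul_le_mul_of_nonneg_left hMlow (by positivity))
      have e8 : (8 : ℝ) ^ n = 2 ^ ((n : ℝ) * 3) := by
        rw [mul_comm, Real.rpow_mul_natCast (by norm_num)]
        norm_num
      rw [e8, ← Real.rpow_mul_natCast (by norm_num), mul_comm (8 : ℝ), mul_assoc,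
        mul_div_cancel₀ _ (by norm_num : (8 : ℝ) ≠ 0), ← Real.rpow_add (by norm_num),
        ← Real.rpow_add (by norm_num), ← hδ']
      congr 1
      ring
    linarith
  have hl : Filter.Tendsto (fun n => 1 - 2 * errProbNoFB (dueckW p) n R0 R1 R2 (enc n) (dec1 n)
      (dec2 n)) Filter.atTop (nhds (1 - 2 * 0)) := (hlim.const_mul 2).const_sub 1
  have hr : Filter.Tendsto (fun n : ℕ => ρ ^ n + 8 * ((2 : ℝ) ^ (-δ)) ^ n) Filter.atTop
      (nhds (0 + 8 * 0)) :=
    (tendsto_pow_atTop_nhds_zero_of_lt_one hρ0 hρ1).add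
      ((tendsto_pow_atTop_nhds_zero_of_lt_one (by positivity)
        (Real.rpow_lt_one_of_one_lt_of_neg (by norm_num) (by linarith))).const_mul 8)
  have := le_of_tendsto_of_tendsto' hl hr hbound
  norm_num at this

lemma sum_rate_le_of_mem_CNoFB {p : Bool × Bool × Bool → ℝ} (hp : IsPMF p) {r : ℝ × ℝ × ℝ}
    (h : r ∈ CNoFB (dueckW p)) :
    r.1 + r.2.1 + r.2.2 ≤ 3 - crossEnt (markovLaw p) (markovLaw p) := by
  have hc : IsClosed {r : ℝ × ℝ × ℝ | r.1 + r.2.1 + r.2.2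
      ≤ 3 - crossEnt (markovLaw p) (markovLaw p)} :=
    isClosed_le (by fun_prop) continuous_const
  exact closure_minimal (fun r hr => AchievableNoFB.sum_rate_le hp hr) hc h

/-- A causal feedback code over the Dueck channel errs at most as often as the noise is bad. -/
lemma errProbFB_noiselessExt_dueckW_le {p : Bool × Bool × Bool → ℝ} (hp : IsPMF p) (n : ℕ)
    (R0 R1 R2 : ℝ)
    (enc : Fin n → Fin (msgCard n R0) × Fin (msgCard n R1) × Fin (msgCard n R2) →
      (Fin n → (Bool × Bool) × Bool × Bool) → Bool × Bool × Bool) (hc : Causal n enc)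
    (dec1 : (Fin n → Bool × Bool) → Fin (msgCard n R0) × Fin (msgCard n R1))
    (dec2 : (Fin n → Bool × Bool) → Fin (msgCard n R0) × Fin (msgCard n R2))
    (good : Fin (msgCard n R0) × Fin (msgCard n R1) × Fin (msgCard n R2) →
      (Fin n → Bool × Bool × Bool) → Prop)
    (hgood : ∀ m v, good m (fun t => noiseOf (enc t m (outPair ∘ v)) (v t)) →
      dec1 (fun t => (outPair (v t)).1) = (m.1, m.2.1) ∧
        dec2 (fun t => (outPair (v t)).2) = (m.1, m.2.2)) :
    errProbFB (noiselessExt (dueckW p)) n R0 R1 R2 enc dec1 dec2 ≤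
      (1 / ((msgCard n R0 : ℝ) * (msgCard n R1 : ℝ) * (msgCard n R2 : ℝ))) *
        ∑ m, ∑ z : Fin n → Bool × Bool × Bool,
          (∏ t, p (z t)) * (if good m z then 0 else 1) := by
  simp only [errProbFB]
  refine mul_le_mul_of_nonneg_left (Finset.sum_le_sum fun m _ => ?_) (by positivity)
  rw [sum_prod_mul_comp (α := Bool × Bool × Bool)
    (o := fun v => ((outPair v).1, (outPair v).2, outPair v))
    (fun a b h => outPair_injective (by simpa using congrArg (fun q => q.2.2) h))
    (fun y t => noiselessExt (dueckW p) (enc t m fun s => (y s).2.2) (y t))]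
  swap
  · intro y t h
    simp only [noiselessExt]
    split_ifs with h'
    · refine dueckW_eq_zero fun ⟨v, hv⟩ => h ⟨v, ?_⟩
      simp only [hv]
      exact Prod.ext rfl (Prod.ext rfl h'.symm)
    · rfl
  have hw : ∀ (x v : Bool × Bool × Bool), noiselessExt (dueckW p) x
      ((outPair v).1, (outPair v).2, outPair v) = p (noiseOf x v) := by
    intro x v
    simp only [noiselessExt, if_true]
    exact dueckW_outPair p x v
  simp only [Function.comp_apply, hw]
  let Z (v : Fin n → Bool × Bool × Bool) (t : Fin n) := noiseOf (enc t m (outPair ∘ v)) (v t)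
  have hZ : Function.Injective Z := by
    intro v v' h
    have key : ∀ k : ℕ, ∀ t : Fin n, (t : ℕ) = k → v t = v' t := by
      intro k
      induction k using Nat.strong_induction_on with
      | _ k ih =>
        intro t ht
        have h1 : enc t m (outPair ∘ v) = enc t m (outPair ∘ v') :=
          hc t m _ _ fun s hs => congrArg outPair (ih s (ht ▸ hs) s rfl)
        have h2 := congrFun h t
        simp only [Z, h1] at h2
        exact noiseOf_injective _ h2
    exact funext fun t => key t t rfl
  have hZb := Finite.injective_iff_bijective.1 hZ
  rw [← hZb.sum_comp fun z => (∏ t, p (z t)) * (if good m z then (0 : ℝ) else 1)]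
  refine Finset.sum_le_sum fun v _ => mul_le_mul_of_nonneg_left ?_
    (Finset.prod_nonneg fun t _ => hp.1 _)
  by_cases h : good m (Z v)
  · obtain ⟨h1, h2⟩ := hgood m v h
    rw [if_pos h, if_neg]
    simp only [h1, h2]
    tauto
  · rw [if_neg h]
    split_ifs <;> norm_num

/-- Bitwise sum of two binary sequences. -/
def xorSeq {k : ℕ} (u v : Fin k → Bool) : Fin k → Bool := fun i => Bool.xor (u i) (v i)

lemma xorSeq_cancel {k : ℕ} (u v : Fin k → Bool) : xorSeq (xorSeq u v) u = v := by
  funext i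
  simp only [xorSeq]
  cases u i <;> cases v i <;> rfl

lemma xorSeq_bijective {k : ℕ} (u : Fin k → Bool) : Function.Bijective (xorSeq u) :=
  Finite.injective_iff_bijective.1 fun v v' h => by
    rw [← xorSeq_cancel u v, ← xorSeq_cancel u v', h]

/-- Pairwise independence of the codewords of a uniformly random codebook. -/
lemma sum_codebook_ite {A : Type*} [Fintype A] [DecidableEq A] {k : ℕ} {a a' : A} (h : a ≠ a')
    (S : (Fin k → Bool) → Prop) (u : Fin k → Bool) :
    ∑ c : A → Fin k → Bool, (if S (xorSeq (xorSeq (c a) u) (c a')) then (1 : ℝ) else 0)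
      = (Fintype.card (A → Fin k → Bool) : ℝ) *
        ((Finset.univ.filter S).card / 2 ^ k) := by
  have e1 : ∀ f : (A → Fin k → Bool) → ℝ, ∑ c, f c
      = ∑ r : {j // j ≠ a'} → Fin k → Bool, ∑ w : Fin k → Bool,
        f ((Equiv.funSplitAt a' (Fin k → Bool)).symm (w, r)) := by
    intro f
    rw [← (Equiv.funSplitAt a' (Fin k → Bool)).symm.sum_comp, Fintype.sum_prod_type_right]
  have e2 : (Fintype.card (A → Fin k → Bool) : ℝ)
      = Fintype.card ({j // j ≠ a'} → Fin k → Bool) * 2 ^ k := by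
    rw [Fintype.card_congr (Equiv.funSplitAt a' (Fin k → Bool)), Fintype.card_prod]
    simp [mul_comm]
  rw [e1, e2, mul_assoc, mul_div_cancel₀ _ (by positivity)]
  have e3 : ∀ r : {j // j ≠ a'} → Fin k → Bool, ∑ w : Fin k → Bool,
      (if S (xorSeq (xorSeq ((Equiv.funSplitAt a' (Fin k → Bool)).symm (w, r) a) u)
        ((Equiv.funSplitAt a' (Fin k → Bool)).symm (w, r) a')) then (1 : ℝ) else 0)
      = (Finset.univ.filter S).card := by
    intro r
    have ha : ∀ w, (Equiv.funSplitAt a' (Fin k → Bool)).symm (w, r) a = r ⟨a, h⟩ := by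
      intro w; simp [Equiv.funSplitAt, Equiv.piSplitAt, h]
    have ha' : ∀ w, (Equiv.funSplitAt a' (Fin k → Bool)).symm (w, r) a' = w := by
      intro w; simp [Equiv.funSplitAt, Equiv.piSplitAt]
    simp only [ha, ha']
    rw [(xorSeq_bijective (xorSeq (r ⟨a, h⟩) u)).sum_comp
      fun w => if S w then (1 : ℝ) else 0, Finset.sum_boole]
  simp only [e3, Finset.sum_const, Finset.card_univ, nsmul_eq_mul]

/-- Averaging over codebooks. -/
lemma exists_codebook {C M Z : Type*} [Fintype C] [Nonempty C] [Fintype M] [Fintype Z]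
    {w β : Z → ℝ} (hw : ∀ z, 0 ≤ w z) {F : C → M → Z → ℝ}
    (hF : ∀ m z, ∑ c, F c m z ≤ Fintype.card C * β z) :
    ∃ c, ∑ m, ∑ z, w z * F c m z ≤ Fintype.card M * ∑ z, w z * β z := by
  have h : ∑ c, ∑ m, ∑ z, w z * F c m z
      ≤ ∑ _c : C, Fintype.card M * ∑ z, w z * β z := by
    rw [Finset.sum_comm]
    calc _ ≤ ∑ _m : M, Fintype.card C * ∑ z, w z * β z := by
          refine Finset.sum_le_sum fun m _ => ?_
          rw [Finset.sum_comm, Finset.mul_sum]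
          refine Finset.sum_le_sum fun z _ => ?_
          rw [← Finset.mul_sum]
          have := mul_le_mul_of_nonneg_left (hF m z) (hw z)
          linarith
      _ = _ := by
          simp only [Finset.sum_const, Finset.card_univ, nsmul_eq_mul]
          ring
  obtain ⟨c, -, hc⟩ := Finset.exists_le_of_sum_le Finset.univ_nonempty h
  exact ⟨c, hc⟩

/-- Typicality tests: for the noise `Z₀` of a block, for `Z₁` given `Z₀`, and for `Z₂` given
`(Z₀, Z₁)`, the latter two on the first `L` letters of a block. -/
structure TypTests (N L : ℕ) where
  t0 : (Fin N → Bool) → Prop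
  t1 : (Fin L → Bool) → (Fin L → Bool) → Prop
  t2 : (Fin L → Bool) → (Fin L → Bool) → (Fin L → Bool) → Prop

/-- Codebooks: one for the common input, indexed by fresh data and a past noise `Z₁`, and one for
the second input. -/
abbrev Codebooks (N L : ℕ) (K0 K2 : Type*) :=
  (K0 × (Fin L → Bool) → Fin N → Bool) × (K2 → Fin L → Bool)

section Block

variable {N L B : ℕ} {K0 K2 : Type*}

/-- The first `L` letters of a block. -/
def firstLetters (hL : L ≤ N) (w : Fin N → Bool) : Fin L → Bool := fun i => w (Fin.castLE hL i)

/-- The noises are typical and no wrong codeword is confusable in any block. -/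
def GoodNoise (T : TypTests N L) (hL : L ≤ N) (c : Codebooks N L K0 K2) (m0 : Fin B → K0)
    (m2 : Fin B → K2) (z0 : Fin (B + 1) → Fin N → Bool) (z1 z2 : Fin B → Fin L → Bool) : Prop :=
  ∀ b, T.t0 (z0 b.succ) ∧ T.t1 (firstLetters hL (z0 b.castSucc)) (z1 b) ∧
    T.t2 (firstLetters hL (z0 b.castSucc)) (z1 b) (z2 b) ∧
    (∀ a, a ≠ (m0 b, z1 b) → T.t1 (firstLetters hL (z0 b.castSucc)) a.2 →
      ¬ T.t0 (xorSeq (xorSeq (c.1 (m0 b, z1 b)) (z0 b.succ)) (c.1 a))) ∧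
    ∀ k, k ≠ m2 b → ¬ T.t2 (firstLetters hL (z0 b.castSucc)) (z1 b)
      (xorSeq (xorSeq (c.2 (m2 b)) (z2 b)) (c.2 k))

/-- The noise `Z₀` implied by a guess of the common codewords. -/
def noiseGuess (c : Codebooks N L K0 K2) (y0 : Fin (B + 1) → Fin N → Bool)
    (σ : Fin B → K0 × (Fin L → Bool)) : Fin (B + 1) → Fin N → Bool :=
  Fin.cases (motive := fun _ => Fin N → Bool) (y0 0) fun b => xorSeq (y0 b.succ) (c.1 (σ b))

/-- A guess of the common codewords passes all typicality tests. -/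
def Consistent (T : TypTests N L) (hL : L ≤ N) (c : Codebooks N L K0 K2)
    (y0 : Fin (B + 1) → Fin N → Bool) (σ : Fin B → K0 × (Fin L → Bool)) : Prop :=
  ∀ b, T.t1 (firstLetters hL (noiseGuess c y0 σ b.castSucc)) (σ b).2 ∧
    T.t0 (noiseGuess c y0 σ b.succ)

/-- Decoder of the common codewords. -/
def decodeCommon [Nonempty K0] (T : TypTests N L) (hL : L ≤ N) (c : Codebooks N L K0 K2)
    (y0 : Fin (B + 1) → Fin N → Bool) : Fin B → K0 × (Fin L → Bool) :=
  Classical.epsilon (Consistent T hL c y0)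

/-- Decoder of the second codewords. -/
def decodeSecond [Nonempty K0] [Nonempty K2] (T : TypTests N L) (hL : L ≤ N) (c : Codebooks N L K0 K2)
    (y0 : Fin (B + 1) → Fin N → Bool) (y2 : Fin B → Fin L → Bool) (b : Fin B) : K2 :=
  Classical.epsilon fun k =>
    T.t2 (firstLetters hL (noiseGuess c y0 (decodeCommon T hL c y0) b.castSucc))
      (decodeCommon T hL c y0 b).2 (xorSeq (y2 b) (c.2 k))

variable {T : TypTests N L} {hL : L ≤ N} {c : Codebooks N L K0 K2} {m0 : Fin B → K0}
  {m2 : Fin B → K2} {z0 : Fin (B + 1) → Fin N → Bool} {z1 z2 : Fin B → Fin L → Bool}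
  {y0 : Fin (B + 1) → Fin N → Bool} {y2 : Fin B → Fin L → Bool}

lemma noiseGuess_eq (h0 : y0 0 = z0 0)
    (hs : ∀ b : Fin B, y0 b.succ = xorSeq (c.1 (m0 b, z1 b)) (z0 b.succ)) :
    noiseGuess c y0 (fun b => (m0 b, z1 b)) = z0 := by
  funext b
  refine Fin.cases ?_ (fun b => ?_) b
  · exact h0
  · simp only [noiseGuess, Fin.cases_succ, hs, xorSeq_cancel]

lemma GoodNoise.eq_of_consistent (hg : GoodNoise T hL c m0 m2 z0 z1 z2) (h0 : y0 0 = z0 0)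
    (hs : ∀ b : Fin B, y0 b.succ = xorSeq (c.1 (m0 b, z1 b)) (z0 b.succ))
    {σ : Fin B → K0 × (Fin L → Bool)} (hσ : Consistent T hL c y0 σ) :
    σ = fun b => (m0 b, z1 b) := by
  have step : ∀ b : Fin B, noiseGuess c y0 σ b.castSucc = z0 b.castSucc →
      σ b = (m0 b, z1 b) := by
    intro b hb
    by_contra hne
    obtain ⟨h1, h2⟩ := hσ b
    rw [hb] at h1
    apply (hg b).2.2.2.1 _ hne h1
    simpa only [noiseGuess, Fin.cases_succ, hs] using h2
  have key : ∀ b : Fin (B + 1), noiseGuess c y0 σ b = z0 b := by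
    intro b
    induction b using Fin.induction with
    | zero => exact h0
    | succ b ih =>
      simp only [noiseGuess, Fin.cases_succ, hs, step b ih, xorSeq_cancel]
  exact funext fun b => step b (key _)

lemma GoodNoise.decodeCommon_eq [Nonempty K0] (hg : GoodNoise T hL c m0 m2 z0 z1 z2) (h0 : y0 0 = z0 0)
    (hs : ∀ b : Fin B, y0 b.succ = xorSeq (c.1 (m0 b, z1 b)) (z0 b.succ)) :
    decodeCommon T hL c y0 = fun b => (m0 b, z1 b) := by
  refine hg.eq_of_consistent h0 hs (Classical.epsilon_spec (p := Consistent T hL c y0)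
    ⟨fun b => (m0 b, z1 b), fun b => ?_⟩)
  rw [noiseGuess_eq h0 hs]
  exact ⟨(hg b).2.1, (hg b).1⟩

lemma GoodNoise.decodeSecond_eq [Nonempty K0] [Nonempty K2]
    (hg : GoodNoise T hL c m0 m2 z0 z1 z2) (h0 : y0 0 = z0 0)
    (hs : ∀ b : Fin B, y0 b.succ = xorSeq (c.1 (m0 b, z1 b)) (z0 b.succ))
    (h2 : ∀ b, y2 b = xorSeq (c.2 (m2 b)) (z2 b)) :
    decodeSecond T hL c y0 y2 = m2 := by
  funext b
  have hspec := Classical.epsilon_spec (p := fun k =>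
    T.t2 (firstLetters hL (noiseGuess c y0 (decodeCommon T hL c y0) b.castSucc))
      (decodeCommon T hL c y0 b).2 (xorSeq (y2 b) (c.2 k))) ⟨m2 b, by
        rw [hg.decodeCommon_eq h0 hs, noiseGuess_eq h0 hs, h2, xorSeq_cancel]
        exact (hg b).2.2.1⟩
  change T.t2 _ _ (xorSeq _ (c.2 (decodeSecond T hL c y0 y2 b))) at hspec
  by_contra hne
  generalize decodeSecond T hL c y0 y2 b = k at hspec hne
  rw [hg.decodeCommon_eq h0 hs, noiseGuess_eq h0 hs, h2] at hspec
  exact (hg b).2.2.2.2 k hne hspec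

end Block

section Average

variable {N L B : ℕ} {K0 K2 : Type*} [Fintype K0] [Fintype K2]

/-- Union bound averaged over the codebooks. -/
lemma sum_codebooks_not_goodNoise_le (T : TypTests N L) (hL : L ≤ N) {s0 s1 s2 : ℝ}
    (h0 : ((Finset.univ.filter T.t0).card : ℝ) ≤ s0)
    (h1 : ∀ u, ((Finset.univ.filter (T.t1 u)).card : ℝ) ≤ s1)
    (h2 : ∀ u v, ((Finset.univ.filter (T.t2 u v)).card : ℝ) ≤ s2)
    (m0 : Fin B → K0) (m2 : Fin B → K2) (z0 : Fin (B + 1) → Fin N → Bool)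
    (z1 z2 : Fin B → Fin L → Bool) :
    ∑ c : Codebooks N L K0 K2, (if GoodNoise T hL c m0 m2 z0 z1 z2 then (0 : ℝ) else 1)
      ≤ Fintype.card (Codebooks N L K0 K2) *
        ∑ b : Fin B, ((if ¬ T.t0 (z0 b.succ) then 1 else 0)
          + (if ¬ T.t1 (firstLetters hL (z0 b.castSucc)) (z1 b) then 1 else 0)
          + (if ¬ T.t2 (firstLetters hL (z0 b.castSucc)) (z1 b) (z2 b) then 1 else 0)
          + Fintype.card K0 * s1 * s0 / 2 ^ N + Fintype.card K2 * s2 / 2 ^ L) := by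
  let e0 (c : Codebooks N L K0 K2) (b : Fin B) : ℝ :=
    ∑ a ∈ (Finset.univ.filter fun a : K0 × (Fin L → Bool) =>
        T.t1 (firstLetters hL (z0 b.castSucc)) a.2).erase (m0 b, z1 b),
      if T.t0 (xorSeq (xorSeq (c.1 (m0 b, z1 b)) (z0 b.succ)) (c.1 a)) then 1 else 0
  let e2 (c : Codebooks N L K0 K2) (b : Fin B) : ℝ :=
    ∑ k ∈ Finset.univ.erase (m2 b),
      if T.t2 (firstLetters hL (z0 b.castSucc)) (z1 b)
        (xorSeq (xorSeq (c.2 (m2 b)) (z2 b)) (c.2 k)) then 1 else 0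
  have hs0 : 0 ≤ s0 := le_trans (Nat.cast_nonneg _) h0
  have hunion : ∀ c : Codebooks N L K0 K2,
      (if GoodNoise T hL c m0 m2 z0 z1 z2 then (0 : ℝ) else 1) ≤
        ∑ b : Fin B, ((if ¬ T.t0 (z0 b.succ) then 1 else 0)
          + (if ¬ T.t1 (firstLetters hL (z0 b.castSucc)) (z1 b) then 1 else 0)
          + (if ¬ T.t2 (firstLetters hL (z0 b.castSucc)) (z1 b) (z2 b) then 1 else 0)
          + e0 c b + e2 c b) := by
    intro c
    have i0 : ∀ b, 0 ≤ e0 c b := fun b => Finset.sum_nonneg fun a _ => by split_ifs <;> norm_num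
    have i2 : ∀ b, 0 ≤ e2 c b := fun b => Finset.sum_nonneg fun a _ => by split_ifs <;> norm_num
    have j : ∀ (P : Prop) [Decidable P], (0 : ℝ) ≤ if P then 1 else 0 := fun P _ => by split_ifs <;> norm_num
    have hnn : ∀ b : Fin B, (0 : ℝ) ≤ (if ¬ T.t0 (z0 b.succ) then 1 else 0)
          + (if ¬ T.t1 (firstLetters hL (z0 b.castSucc)) (z1 b) then 1 else 0)
          + (if ¬ T.t2 (firstLetters hL (z0 b.castSucc)) (z1 b) (z2 b) then 1 else 0)
          + e0 c b + e2 c b := fun b =>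
      add_nonneg (add_nonneg (add_nonneg (add_nonneg (j _) (j _)) (j _)) (i0 b)) (i2 b)
    split_ifs with hg
    · exact Finset.sum_nonneg fun b _ => hnn b
    · simp only [GoodNoise, not_forall] at hg
      obtain ⟨b, hb⟩ := hg
      refine le_trans ?_ (Finset.single_le_sum (fun b _ => hnn b) (Finset.mem_univ b))
      have j0 := j (¬ T.t0 (z0 b.succ))
      have j1 := j (¬ T.t1 (firstLetters hL (z0 b.castSucc)) (z1 b))
      have j2 := j (¬ T.t2 (firstLetters hL (z0 b.castSucc)) (z1 b) (z2 b))
      have k0 := i0 b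
      have k2 := i2 b
      by_cases c0 : T.t0 (z0 b.succ)
      swap
      · rw [if_pos c0] at j0 ⊢; linarith
      by_cases c1 : T.t1 (firstLetters hL (z0 b.castSucc)) (z1 b)
      swap
      · rw [if_pos c1] at j1 ⊢; linarith
      by_cases c2 : T.t2 (firstLetters hL (z0 b.castSucc)) (z1 b) (z2 b)
      swap
      · rw [if_pos c2] at j2 ⊢; linarith
      by_cases c3 : ∀ a, a ≠ (m0 b, z1 b) → T.t1 (firstLetters hL (z0 b.castSucc)) a.2 →
          ¬ T.t0 (xorSeq (xorSeq (c.1 (m0 b, z1 b)) (z0 b.succ)) (c.1 a))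
      · have c4 : ¬ ∀ k, k ≠ m2 b → ¬ T.t2 (firstLetters hL (z0 b.castSucc)) (z1 b)
            (xorSeq (xorSeq (c.2 (m2 b)) (z2 b)) (c.2 k)) := fun c4 => hb ⟨c0, c1, c2, c3, c4⟩
        push Not at c4
        obtain ⟨k, hk, hk2⟩ := c4
        have : 1 ≤ e2 c b := by
          refine le_trans ?_ (Finset.single_le_sum (fun _ _ => j _)
            (Finset.mem_erase.2 ⟨hk, Finset.mem_univ k⟩))
          rw [if_pos hk2]
        linarith
      · push Not at c3
        obtain ⟨a, ha, ha1, ha2⟩ := c3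
        have : 1 ≤ e0 c b := by
          refine le_trans ?_ (Finset.single_le_sum (fun _ _ => j _)
            (Finset.mem_erase.2 ⟨ha, Finset.mem_filter.2 ⟨Finset.mem_univ a, ha1⟩⟩))
          rw [if_pos ha2]
        linarith
  have hE0 : ∀ b, ∑ c, e0 c b ≤ Fintype.card (Codebooks N L K0 K2) *
      (Fintype.card K0 * s1 * s0 / 2 ^ N) := by
    intro b
    have hcard : (((Finset.univ.filter fun a : K0 × (Fin L → Bool) =>
        T.t1 (firstLetters hL (z0 b.castSucc)) a.2).erase (m0 b, z1 b)).card : ℝ)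
        ≤ Fintype.card K0 * s1 := by
      have : (Finset.univ.filter fun a : K0 × (Fin L → Bool) =>
          T.t1 (firstLetters hL (z0 b.castSucc)) a.2) = Finset.univ ×ˢ
          Finset.univ.filter (T.t1 (firstLetters hL (z0 b.castSucc))) := by
        ext a; simp
      refine le_trans (Nat.cast_le.2 (Finset.card_erase_le)) ?_
      rw [this, Finset.card_product, Nat.cast_mul, Finset.card_univ]
      exact mul_le_mul_of_nonneg_left (h1 _) (Nat.cast_nonneg _)
    simp only [e0]
    rw [Finset.sum_comm]
    have hterm : ∀ a ∈ (Finset.univ.filter fun a : K0 × (Fin L → Bool) =>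
        T.t1 (firstLetters hL (z0 b.castSucc)) a.2).erase (m0 b, z1 b),
        ∑ c : Codebooks N L K0 K2,
          (if T.t0 (xorSeq (xorSeq (c.1 (m0 b, z1 b)) (z0 b.succ)) (c.1 a)) then (1 : ℝ) else 0)
          ≤ Fintype.card (Codebooks N L K0 K2) * (s0 / 2 ^ N) := by
      intro a ha
      rw [Fintype.sum_prod_type_right]
      simp only [sum_codebook_ite (Finset.ne_of_mem_erase ha).symm, Finset.sum_const,
        Finset.card_univ, nsmul_eq_mul, Fintype.card_prod, Nat.cast_mul]
      rw [← mul_assoc, mul_comm (Fintype.card (K2 → Fin L → Bool) : ℝ)]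
      gcongr
    refine le_trans (Finset.sum_le_sum hterm) ?_
    rw [Finset.sum_const, nsmul_eq_mul]
    calc _ ≤ Fintype.card K0 * s1 * (Fintype.card (Codebooks N L K0 K2) * (s0 / 2 ^ N)) := by
          gcongr
      _ = _ := by ring
  have hE2 : ∀ b, ∑ c, e2 c b ≤ Fintype.card (Codebooks N L K0 K2) *
      (Fintype.card K2 * s2 / 2 ^ L) := by
    intro b
    have hs2 : 0 ≤ s2 := le_trans (Nat.cast_nonneg _)
      (h2 (firstLetters hL (z0 b.castSucc)) (z1 b))
    simp only [e2]
    rw [Finset.sum_comm]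
    have hterm : ∀ k ∈ Finset.univ.erase (m2 b), ∑ c : Codebooks N L K0 K2,
          (if T.t2 (firstLetters hL (z0 b.castSucc)) (z1 b)
            (xorSeq (xorSeq (c.2 (m2 b)) (z2 b)) (c.2 k)) then (1 : ℝ) else 0)
          ≤ Fintype.card (Codebooks N L K0 K2) * (s2 / 2 ^ L) := by
      intro k hk
      rw [Fintype.sum_prod_type]
      simp only [sum_codebook_ite (Finset.ne_of_mem_erase hk).symm, Finset.sum_const,
        Finset.card_univ, nsmul_eq_mul, Fintype.card_prod, Nat.cast_mul]
      rw [← mul_assoc]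
      gcongr
      exact h2 _ _
    refine le_trans (Finset.sum_le_sum hterm) ?_
    rw [Finset.sum_const, nsmul_eq_mul]
    calc _ ≤ Fintype.card K2 * (Fintype.card (Codebooks N L K0 K2) * (s2 / 2 ^ L)) := by
          gcongr
          exact Finset.card_le_univ _
      _ = _ := by ring
  refine le_trans (Finset.sum_le_sum fun c _ => hunion c) ?_
  rw [Finset.sum_comm, Finset.mul_sum]
  refine Finset.sum_le_sum fun b _ => ?_
  simp only [Finset.sum_add_distrib, Finset.sum_const, Finset.card_univ, nsmul_eq_mul]
  have := hE0 b
  have := hE2 b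
  simp only [mul_add]
  linarith

end Average

section BlockCode

variable {N L B n : ℕ} {K0 K2 : Type*}

/-- Time of the letter `i` of the block `b`. -/
def blockTime (hn : (B + 1) * N ≤ n) (b : Fin (B + 1)) (i : Fin N) : Fin n :=
  Fin.castLE hn (finProdFinEquiv (b, i))

lemma blockTime_inj (hn : (B + 1) * N ≤ n) {b b' : Fin (B + 1)} {i i' : Fin N} :
    blockTime hn b i = blockTime hn b' i' ↔ b = b' ∧ i = i' := by
  rw [blockTime, blockTime, (Fin.castLE_injective hn).eq_iff, finProdFinEquiv.injective.eq_iff,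
    Prod.mk_inj]

/-- A sequence cut into blocks. -/
def inBlocks {α : Type*} (hn : (B + 1) * N ≤ n) (z : Fin n → α) (b : Fin (B + 1)) :
    Fin N → α :=
  fun i => z (blockTime hn b i)

/-- Input at the letter `i` of the block `b`: the first input carries uncoded data, the common
input carries fresh data together with the noise `Z₁` of the previous block, which is computed
from the first output `w`, and the second input carries coded data. -/
def blockInput (hL : L ≤ N) (c : Codebooks N L K0 K2) (μ : Fin B → K0 × (Fin L → Bool))
    (ν : Fin B → K2) (w : Fin (B + 1) → Fin N → Bool) (b : Fin (B + 1)) (i : Fin N) :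
    Bool × Bool × Bool :=
  (Fin.lastCases (motive := fun _ => Bool) false
      (fun b' => if h : (i : ℕ) < L then (μ b').2 ⟨i, h⟩ else false) b,
    Fin.cases (motive := fun _ => Bool) false
      (fun b' => c.1 ((μ b').1, xorSeq (μ b').2 (firstLetters hL (w b'.castSucc))) i) b,
    Fin.lastCases (motive := fun _ => Bool) false
      (fun b' => if h : (i : ℕ) < L then c.2 (ν b') ⟨i, h⟩ else false) b)

/-- The block Markov encoder. -/
def blockEnc (hL : L ≤ N) (c : Codebooks N L K0 K2) (μ : Fin B → K0 × (Fin L → Bool))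
    (ν : Fin B → K2) (hn : (B + 1) * N ≤ n) (t : Fin n)
    (fb : Fin n → (Bool × Bool) × Bool × Bool) : Bool × Bool × Bool :=
  if h : (t : ℕ) < (B + 1) * N then
    blockInput hL c μ ν (inBlocks hn fun s => (fb s).1.1) (finProdFinEquiv.symm ⟨t, h⟩).1
      (finProdFinEquiv.symm ⟨t, h⟩).2
  else (false, false, false)

lemma blockEnc_blockTime (hL : L ≤ N) (c : Codebooks N L K0 K2)
    (μ : Fin B → K0 × (Fin L → Bool)) (ν : Fin B → K2) (hn : (B + 1) * N ≤ n)
    (b : Fin (B + 1)) (i : Fin N) (fb : Fin n → (Bool × Bool) × Bool × Bool) :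
    blockEnc hL c μ ν hn (blockTime hn b i) fb
      = blockInput hL c μ ν (inBlocks hn fun s => (fb s).1.1) b i := by
  have h : ((blockTime hn b i : Fin n) : ℕ) < (B + 1) * N := (finProdFinEquiv (b, i)).2
  have e : (⟨blockTime hn b i, h⟩ : Fin ((B + 1) * N)) = finProdFinEquiv (b, i) := rfl
  rw [blockEnc, dif_pos h, e, Equiv.symm_apply_apply]

lemma blockEnc_causal (hL : L ≤ N) (c : Codebooks N L K0 K2)
    (μ : Fin B → K0 × (Fin L → Bool)) (ν : Fin B → K2) (hn : (B + 1) * N ≤ n) (t : Fin n)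
    {fb fb' : Fin n → (Bool × Bool) × Bool × Bool}
    (hfb : ∀ s : Fin n, (s : ℕ) < t → fb s = fb' s) :
    blockEnc hL c μ ν hn t fb = blockEnc hL c μ ν hn t fb' := by
  by_cases h : (t : ℕ) < (B + 1) * N
  · obtain ⟨⟨b, i⟩, hbi⟩ := (finProdFinEquiv (m := B + 1) (n := N)).surjective ⟨t, h⟩
    obtain rfl : t = blockTime hn b i := Fin.ext (congrArg Fin.val hbi).symm
    rw [blockEnc_blockTime, blockEnc_blockTime, blockInput, blockInput]
    refine Prod.ext rfl (Prod.ext ?_ rfl)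
    revert hfb
    clear hbi h
    refine Fin.cases (fun _ => rfl) (fun b => ?_) b
    intro hfb
    simp only [Fin.cases_succ]
    have e : firstLetters hL (inBlocks hn (fun s => (fb s).1.1) b.castSucc)
        = firstLetters hL (inBlocks hn (fun s => (fb' s).1.1) b.castSucc) := by
      funext j
      simp only [firstLetters, inBlocks]
      rw [hfb]
      simp only [blockTime, Fin.val_castLE, finProdFinEquiv_apply_val, Fin.val_castSucc,
        Fin.val_succ]
      have := j.2
      nlinarith
    rw [e]
  · rw [blockEnc, blockEnc, dif_neg h, dif_neg h]

/-- First receiver: recovers the data in the common and the first input. -/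
def blockDec1 [Nonempty K0] (T : TypTests N L) (hL : L ≤ N) (c : Codebooks N L K0 K2)
    (hn : (B + 1) * N ≤ n) (y : Fin n → Bool × Bool) : Fin B → K0 × (Fin L → Bool) :=
  fun b =>
    ((decodeCommon T hL c (inBlocks hn fun t => (y t).2) b).1,
      xorSeq (decodeCommon T hL c (inBlocks hn fun t => (y t).2) b).2
        (firstLetters hL (inBlocks hn (fun t => (y t).1) b.castSucc)))

/-- Second receiver: recovers the data in the second input. -/
def blockDec2 [Nonempty K0] [Nonempty K2] (T : TypTests N L) (hL : L ≤ N)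
    (c : Codebooks N L K0 K2) (hn : (B + 1) * N ≤ n) (y : Fin n → Bool × Bool) : Fin B → K2 :=
  decodeSecond T hL c (inBlocks hn fun t => (y t).1)
    fun b => firstLetters hL (inBlocks hn (fun t => (y t).2) b.castSucc)

/-- The channel noise is good for the block Markov code. -/
def GoodChannelNoise (T : TypTests N L) (hL : L ≤ N) (c : Codebooks N L K0 K2)
    (hn : (B + 1) * N ≤ n) (μ : Fin B → K0 × (Fin L → Bool)) (ν : Fin B → K2)
    (z : Fin n → Bool × Bool × Bool) : Prop :=
  GoodNoise T hL c (fun b => (μ b).1) ν (inBlocks hn fun t => (z t).1)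
    (fun b => firstLetters hL (inBlocks hn (fun t => (z t).2.1) b.castSucc))
    (fun b => firstLetters hL (inBlocks hn (fun t => (z t).2.2) b.castSucc))

lemma GoodChannelNoise.blockDec_eq [Nonempty K0] [Nonempty K2] {T : TypTests N L}
    {hL : L ≤ N} {c : Codebooks N L K0 K2} {hn : (B + 1) * N ≤ n}
    {μ : Fin B → K0 × (Fin L → Bool)} {ν : Fin B → K2} {v : Fin n → Bool × Bool × Bool}
    (hg : GoodChannelNoise T hL c hn μ ν
      fun t => noiseOf (blockEnc hL c μ ν hn t (outPair ∘ v)) (v t)) :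
    blockDec1 T hL c hn (fun t => (outPair (v t)).1) = μ ∧
      blockDec2 T hL c hn (fun t => (outPair (v t)).2) = ν := by
  set z : Fin n → Bool × Bool × Bool :=
    fun t => noiseOf (blockEnc hL c μ ν hn t (outPair ∘ v)) (v t) with hz
  have hzt : ∀ b i, z (blockTime hn b i) = noiseOf
      (blockInput hL c μ ν (inBlocks hn fun s => (v s).2.1) b i) (v (blockTime hn b i)) := by
    intro b i
    simp only [hz, blockEnc_blockTime]
    rfl
  have hz1 : ∀ b : Fin B, firstLetters hL (inBlocks hn (fun t => (z t).2.1) b.castSucc)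
      = xorSeq (μ b).2 (firstLetters hL (inBlocks hn (fun s => (v s).2.1) b.castSucc)) := by
    intro b
    funext j
    simp [firstLetters, inBlocks, hzt, noiseOf, blockInput, xorSeq]
  have h0 : inBlocks hn (fun t => (v t).1) 0 = inBlocks hn (fun t => (z t).1) 0 := by
    funext i
    simp [inBlocks, hzt, noiseOf, blockInput]
  have hs : ∀ b : Fin B, inBlocks hn (fun t => (v t).1) b.succ
      = xorSeq (c.1 ((μ b).1, firstLetters hL (inBlocks hn (fun t => (z t).2.1) b.castSucc)))
        (inBlocks hn (fun t => (z t).1) b.succ) := by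
    intro b
    rw [hz1]
    funext i
    simp [inBlocks, hzt, noiseOf, blockInput, xorSeq]
  have h2 : ∀ b : Fin B, firstLetters hL (inBlocks hn (fun t => (v t).2.2) b.castSucc)
      = xorSeq (c.2 (ν b))
        (firstLetters hL (inBlocks hn (fun t => (z t).2.2) b.castSucc)) := by
    intro b
    funext j
    simp [firstLetters, inBlocks, hzt, noiseOf, blockInput, xorSeq]
  constructor
  · funext b
    have hd := GoodNoise.decodeCommon_eq hg h0 hs
    refine Prod.ext ?_ ?_
    · exact congrArg (fun q => (q b).1) hd
    · refine (congrArg (fun q => xorSeq (q b).2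
        (firstLetters hL (inBlocks hn (fun t => (v t).2.1) b.castSucc))) hd).trans ?_
      simp only [hz1]
      funext j
      simp [xorSeq]
  · exact GoodNoise.decodeSecond_eq hg h0 hs h2

end BlockCode

lemma exists_injective_fin {α : Type*} [Fintype α] {k : ℕ} (h : k ≤ Fintype.card α) :
    ∃ f : Fin k → α, Function.Injective f := by
  obtain ⟨f⟩ := Function.Embedding.nonempty_of_card_le (α := Fin k) (β := α) (by simpa using h)
  exact ⟨f, f.injective⟩

lemma msgCard_zero (n : ℕ) : msgCard n 0 = 1 := by simp [msgCard]

instance (n : ℕ) : Subsingleton (Fin (msgCard n 0)) := by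
  rw [msgCard_zero]; infer_instance

lemma msgCard_pos {n : ℕ} {R : ℝ} (hR : 0 ≤ R) : 0 < msgCard n R :=
  Nat.floor_pos.2 (Real.one_le_rpow one_le_two (by positivity))

/-- The block Markov code, with a good choice of the codebooks. -/
lemma exists_code {p : Bool × Bool × Bool → ℝ} (hp : IsPMF p) {N L B n : ℕ}
    {K0 K2 : Type*} [Fintype K0] [Fintype K2] [Nonempty K0] [Nonempty K2] {R1 R2 : ℝ}
    (hR1 : 0 ≤ R1) (hR2 : 0 ≤ R2) (T : TypTests N L) (hL : L ≤ N) (hn : (B + 1) * N ≤ n)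
    (hM1 : msgCard n R1 ≤ Fintype.card (Fin B → K0 × (Fin L → Bool)))
    (hM2 : msgCard n R2 ≤ Fintype.card (Fin B → K2)) {s0 s1 s2 ε0 ε1 ε2 : ℝ}
    (h0 : ((Finset.univ.filter T.t0).card : ℝ) ≤ s0)
    (h1 : ∀ u, ((Finset.univ.filter (T.t1 u)).card : ℝ) ≤ s1)
    (h2 : ∀ u v, ((Finset.univ.filter (T.t2 u v)).card : ℝ) ≤ s2)
    (hε0 : ∀ b : Fin B, ∑ z : Fin n → Bool × Bool × Bool, (∏ t, p (z t)) *
      (if ¬ T.t0 (inBlocks hn (fun t => (z t).1) b.succ) then 1 else 0) ≤ ε0)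
    (hε1 : ∀ b : Fin B, ∑ z : Fin n → Bool × Bool × Bool, (∏ t, p (z t)) *
      (if ¬ T.t1 (firstLetters hL (inBlocks hn (fun t => (z t).1) b.castSucc))
        (firstLetters hL (inBlocks hn (fun t => (z t).2.1) b.castSucc)) then 1 else 0) ≤ ε1)
    (hε2 : ∀ b : Fin B, ∑ z : Fin n → Bool × Bool × Bool, (∏ t, p (z t)) *
      (if ¬ T.t2 (firstLetters hL (inBlocks hn (fun t => (z t).1) b.castSucc))
        (firstLetters hL (inBlocks hn (fun t => (z t).2.1) b.castSucc))
        (firstLetters hL (inBlocks hn (fun t => (z t).2.2) b.castSucc)) then 1 else 0) ≤ ε2) :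
    ∃ enc dec1 dec2, Causal n enc ∧
      errProbFB (noiselessExt (dueckW p)) n 0 R1 R2 enc dec1 dec2 ≤
        B * (ε0 + ε1 + ε2 + Fintype.card K0 * s1 * s0 / 2 ^ N + Fintype.card K2 * s2 / 2 ^ L) := by
  obtain ⟨g1, hg1⟩ := exists_injective_fin hM1
  obtain ⟨g2, hg2⟩ := exists_injective_fin hM2
  have : Nonempty (Fin (msgCard n R1)) := ⟨⟨0, msgCard_pos hR1⟩⟩
  have : Nonempty (Fin (msgCard n R2)) := ⟨⟨0, msgCard_pos hR2⟩⟩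
  let z0 (z : Fin n → Bool × Bool × Bool) := inBlocks hn fun t => (z t).1
  let z1 (z : Fin n → Bool × Bool × Bool) (b : Fin B) :=
    firstLetters hL (inBlocks hn (fun t => (z t).2.1) b.castSucc)
  let z2 (z : Fin n → Bool × Bool × Bool) (b : Fin B) :=
    firstLetters hL (inBlocks hn (fun t => (z t).2.2) b.castSucc)
  obtain ⟨c, hc⟩ := exists_codebook (C := Codebooks N L K0 K2)
    (M := Fin (msgCard n 0) × Fin (msgCard n R1) × Fin (msgCard n R2))
    (w := fun z : Fin n → Bool × Bool × Bool => ∏ t, p (z t))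
    (fun z => Finset.prod_nonneg fun t _ => hp.1 _)
    (F := fun c m z => if GoodChannelNoise T hL c hn (g1 m.2.1) (g2 m.2.2) z then 0 else 1)
    (fun m z => sum_codebooks_not_goodNoise_le T hL h0 h1 h2 (fun b => (g1 m.2.1 b).1)
      (g2 m.2.2) (z0 z) (z1 z) (z2 z))
  let enc (t : Fin n) (m : Fin (msgCard n 0) × Fin (msgCard n R1) × Fin (msgCard n R2))
      (fb : Fin n → (Bool × Bool) × Bool × Bool) : Bool × Bool × Bool :=
    blockEnc hL c (g1 m.2.1) (g2 m.2.2) hn t fb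
  let dec1 (y : Fin n → Bool × Bool) : Fin (msgCard n 0) × Fin (msgCard n R1) :=
    (⟨0, msgCard_pos le_rfl⟩, Function.invFun g1 (blockDec1 T hL c hn y))
  let dec2 (y : Fin n → Bool × Bool) : Fin (msgCard n 0) × Fin (msgCard n R2) :=
    (⟨0, msgCard_pos le_rfl⟩, Function.invFun g2 (blockDec2 T hL c hn y))
  have hcausal : Causal n enc := fun t m fb fb' h => blockEnc_causal hL c _ _ hn t h
  have herr := errProbFB_noiselessExt_dueckW_le hp n 0 R1 R2 enc hcausal dec1 dec2
    (fun m z => GoodChannelNoise T hL c hn (g1 m.2.1) (g2 m.2.2) z) (by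
      intro m v hg
      obtain ⟨e1, e2⟩ := hg.blockDec_eq
      simp only [dec1, dec2, e1, e2, Function.leftInverse_invFun hg1 _,
        Function.leftInverse_invFun hg2 _]
      exact ⟨Prod.ext (Subsingleton.elim _ _) rfl, Prod.ext (Subsingleton.elim _ _) rfl⟩)
  refine ⟨enc, dec1, dec2, hcausal, herr.trans ?_⟩
  clear herr
  have hM : (Fintype.card (Fin (msgCard n 0) × Fin (msgCard n R1) × Fin (msgCard n R2)) : ℝ)
      = (msgCard n 0 : ℝ) * (msgCard n R1 : ℝ) * (msgCard n R2 : ℝ) := by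
    simp [mul_assoc]
  have hMpos : (0 : ℝ) < (msgCard n 0 : ℝ) * (msgCard n R1 : ℝ) * (msgCard n R2 : ℝ) := by
    have := msgCard_pos (n := n) (le_refl (0 : ℝ))
    have := msgCard_pos (n := n) hR1
    have := msgCard_pos (n := n) hR2
    positivity
  refine (mul_le_mul_of_nonneg_left hc (by positivity)).trans ?_
  rw [hM, ← mul_assoc, one_div_mul_cancel hMpos.ne', one_mul]
  simp only [Finset.mul_sum]
  rw [Finset.sum_comm]
  refine (Finset.sum_le_sum (g := fun _ => ε0 + ε1 + ε2 + Fintype.card K0 * s1 * s0 / 2 ^ N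
    + Fintype.card K2 * s2 / 2 ^ L) fun b _ => ?_).trans_eq ?_
  · have e0 := hε0 b
    have e1 := hε1 b
    have e2 := hε2 b
    have e3 := sum_prod_law hp n
    simp only [mul_add, Finset.sum_add_distrib]
    rw [← Finset.sum_mul, ← Finset.sum_mul, e3, one_mul, one_mul]
    exact add_le_add (add_le_add (add_le_add (add_le_add e0 e1) e2) le_rfl) le_rfl
  · simp; ring

lemma exists_prob_not_typ_le {α : Type*} [Fintype α] {p q : α → ℝ} (hp : IsPMF p)
    (hq : ∀ a, p a ≠ 0 → 0 < q a) {δ : ℝ} (hδ : 0 < δ) :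
    ∃ ρ : ℝ, 0 ≤ ρ ∧ ρ < 1 ∧ ∀ {n k : ℕ} (e : Fin k → Fin n), Function.Injective e →
      ∑ z : Fin n → α, (∏ t, p (z t)) *
        (if ¬ (2 : ℝ) ^ (-(k * (crossEnt p q + δ))) ≤ ∏ i, q (z (e i)) then 1 else 0)
        ≤ ρ ^ k := by
  obtain ⟨ρ, h0, h1, h⟩ := exists_prob_prod_lt_le hp hq hδ
  refine ⟨ρ, h0, h1, fun {n k} e he => ?_⟩
  have := h n (Finset.univ.map ⟨e, he⟩)
  simpa only [Finset.prod_map, Finset.card_map, Finset.card_univ, Fintype.card_fin,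
    Function.Embedding.coeFn_mk, not_le] using this

lemma card_le_of_le_prod {α : Type*} [Fintype α] {n : ℕ} (q : Fin n → α → ℝ)
    (hq : ∀ t a, 0 ≤ q t a) (hs : ∀ t, ∑ a, q t a ≤ 1) (s : ℝ) :
    ((Finset.univ.filter fun z : Fin n → α => (2 : ℝ) ^ (-s) ≤ ∏ t, q t (z t)).card : ℝ)
      ≤ 2 ^ s := by
  have := card_mul_le_one_of_le_prod q hq hs ((2 : ℝ) ^ (-s))
  rwa [Real.rpow_neg zero_le_two s, ← div_eq_mul_inv, div_le_one (by positivity),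
    ← Real.rpow_neg zero_le_two s] at this

/-- The typicality tests built from the laws `P_{Z₀}`, `P_{Z₁|Z₀}` and `P_{Z₂|Z₀Z₁}`. -/
def typTests (p : Bool × Bool × Bool → ℝ) (δ : ℝ) (N L : ℕ) : TypTests N L where
  t0 u := (2 : ℝ) ^ (-(N * (crossEnt p (fun z => mar0 p z.1) + δ))) ≤ ∏ i, mar0 p (u i)
  t1 u v := (2 : ℝ) ^ (-(L * (crossEnt p (fun z => ker1 p z.1 z.2.1) + δ)))
    ≤ ∏ i, ker1 p (u i) (v i)
  t2 u v w := (2 : ℝ) ^ (-(L * (crossEnt p (fun z => ker2 p z.1 z.2.1 z.2.2) + δ)))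
    ≤ ∏ i, ker2 p (u i) (v i) (w i)

/-- Error bound for the block Markov code with typicality tests. -/
lemma exists_code_le {p : Bool × Bool × Bool → ℝ} (hp : IsPMF p) {δ : ℝ} (hδ : 0 < δ) :
    ∃ ρ : ℝ, 0 ≤ ρ ∧ ρ < 1 ∧ ∀ {N L B n k0 k2 : ℕ} {R1 R2 : ℝ}, 0 ≤ R1 → 0 ≤ R2 → L ≤ N →
      (B + 1) * N ≤ n → msgCard n R1 ≤ 2 ^ (B * (k0 + L)) → msgCard n R2 ≤ 2 ^ (B * k2) →
      ∃ enc dec1 dec2, Causal n enc ∧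
        errProbFB (noiselessExt (dueckW p)) n 0 R1 R2 enc dec1 dec2 ≤
          B * (ρ ^ N + ρ ^ L + ρ ^ L
            + 2 ^ k0 * (2 : ℝ) ^ (L * (crossEnt p (fun z => ker1 p z.1 z.2.1) + δ))
                * (2 : ℝ) ^ (N * (crossEnt p (fun z => mar0 p z.1) + δ)) / 2 ^ N
            + 2 ^ k2 * (2 : ℝ) ^ (L * (crossEnt p (fun z => ker2 p z.1 z.2.1 z.2.2) + δ))
                / 2 ^ L) := by
  obtain ⟨ρ0, a0, b0, c0⟩ := exists_prob_not_typ_le hp (q := fun z => mar0 p z.1)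
    (fun z hz => (pos_of_ne_zero hp hz).2.1) hδ
  obtain ⟨ρ1, a1, b1, c1⟩ := exists_prob_not_typ_le hp (q := fun z => ker1 p z.1 z.2.1)
    (fun z hz => div_pos (pos_of_ne_zero hp hz).2.2.1 (pos_of_ne_zero hp hz).2.1) hδ
  obtain ⟨ρ2, a2, b2, c2⟩ := exists_prob_not_typ_le hp (q := fun z => ker2 p z.1 z.2.1 z.2.2)
    (fun z hz => div_pos (pos_of_ne_zero hp hz).1 (pos_of_ne_zero hp hz).2.2.1) hδ
  refine ⟨max ρ0 (max ρ1 ρ2), le_max_of_le_left a0, max_lt b0 (max_lt b1 b2), ?_⟩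
  intro N L B n k0 k2 R1 R2 hR1 hR2 hL hn hM1 hM2
  have hfirst : ∀ b : Fin (B + 1), Function.Injective fun i : Fin L =>
      blockTime hn b (Fin.castLE hL i) := fun b i i' h =>
    Fin.castLE_injective hL ((blockTime_inj hn).1 h).2
  have main := exists_code hp (K0 := Fin k0 → Bool) (K2 := Fin k2 → Bool) hR1 hR2
    (typTests p δ N L) hL hn
    (by simpa [← pow_add, ← pow_mul, mul_comm, add_comm] using hM1)
    (by simpa [← pow_mul, mul_comm] using hM2)
    (card_le_of_le_prod (fun _ => mar0 p) (fun _ => mar0_nonneg hp)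
      (fun _ => (sum_mar0 hp).le) _)
    (fun u => card_le_of_le_prod (fun i => ker1 p (u i)) (fun _ => ker1_nonneg hp _)
      (fun _ => sum_ker1_le_one _) _)
    (fun u v => card_le_of_le_prod (fun i => ker2 p (u i) (v i)) (fun _ => ker2_nonneg hp _ _)
      (fun _ => sum_ker2_le_one _ _) _)
    (ε0 := ρ0 ^ N) (ε1 := ρ1 ^ L) (ε2 := ρ2 ^ L)
    (fun b => c0 (fun i => blockTime hn b.succ i) fun i i' h => ((blockTime_inj hn).1 h).2)
    (fun b => c1 _ (hfirst b.castSucc)) (fun b => c2 _ (hfirst b.castSucc))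
  obtain ⟨enc, dec1, dec2, hc, herr⟩ := main
  refine ⟨enc, dec1, dec2, hc, herr.trans ?_⟩
  simp only [Fintype.card_fun, Fintype.card_bool, Fintype.card_fin, Nat.cast_pow,
    Nat.cast_ofNat]
  gcongr
  · exact le_max_left _ _
  · exact (le_max_left _ _).trans (le_max_right _ _)
  · exact (le_max_right _ _).trans (le_max_right _ _)

lemma noiselessExt_dueckW_nonneg {p : Bool × Bool × Bool → ℝ} (hp : IsPMF p) (x y) :
    0 ≤ noiselessExt (dueckW p) x y := by
  simp only [noiselessExt, dueckW]
  split_ifs <;> first | exact hp.1 _ | exact le_rfl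

/-- Codes for all large blocklengths with vanishing error suffice for achievability. -/
lemma achievableFB_of_eventually {X Y1 Y2 Yt : Type*} [Fintype X] [Nonempty X] [Fintype Y1]
    [Fintype Y2] [Fintype Yt] {W : X → Y1 × Y2 × Yt → ℝ} (hW : ∀ x y, 0 ≤ W x y)
    {R0 R1 R2 : ℝ} (h0 : 0 ≤ R0) (h1 : 0 ≤ R1) (h2 : 0 ≤ R2) {β : ℕ → ℝ}
    (hβ : Filter.Tendsto β Filter.atTop (nhds 0))
    (h : ∀ᶠ n in Filter.atTop, ∃ enc dec1 dec2, Causal n enc ∧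
      errProbFB W n R0 R1 R2 enc dec1 dec2 ≤ β n) : AchievableFB W R0 R1 R2 := by
  have hall : ∀ n, ∃ enc dec1 dec2, Causal n enc ∧
      ((∃ enc dec1 dec2, Causal n enc ∧ errProbFB W n R0 R1 R2 enc dec1 dec2 ≤ β n) →
        errProbFB W n R0 R1 R2 enc dec1 dec2 ≤ β n) := by
    intro n
    by_cases hn : ∃ enc dec1 dec2, Causal n enc ∧ errProbFB W n R0 R1 R2 enc dec1 dec2 ≤ β n
    · obtain ⟨enc, dec1, dec2, hc, herr⟩ := hn
      exact ⟨enc, dec1, dec2, hc, fun _ => herr⟩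
    · exact ⟨fun _ _ _ => Classical.arbitrary X,
        fun _ => (⟨0, msgCard_pos h0⟩, ⟨0, msgCard_pos h1⟩),
        fun _ => (⟨0, msgCard_pos h0⟩, ⟨0, msgCard_pos h2⟩),
        fun _ _ _ _ _ => rfl, fun hn' => absurd hn' hn⟩
  choose enc dec1 dec2 hc herr using hall
  refine ⟨h0, h1, h2, enc, dec1, dec2, hc, ?_⟩
  refine tendsto_of_tendsto_of_tendsto_of_le_of_le' tendsto_const_nhds hβ
    (Filter.Eventually.of_forall fun n => ?_) (h.mono fun n hn => herr n hn)
  refine mul_nonneg (by positivity) (Finset.sum_nonneg fun m _ => Finset.sum_nonneg fun y _ =>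
    mul_nonneg (Finset.prod_nonneg fun t _ => hW _ _) ?_)
  split_ifs <;> norm_num

/-- Choice of the rates. -/
lemma exists_block_parameters {h0 h1 h2 I : ℝ} (hI : 0 < I) (h1I : I ≤ h1) (h2I : h2 ≤ 1 - I) :
    ∃ δ l r2 : ℝ, 0 < δ ∧ 0 < l ∧ l ≤ 1 ∧ 0 < r2 ∧
      (1 - h0 - h1) + l * (h1 + δ) + (h0 + δ) < 1 ∧ r2 < l * (1 - h2 - δ) ∧
      3 - (h0 + h1 + h2 + I) < l + (1 - h0 - h1) + r2 := by
  obtain ⟨a, rfl⟩ : ∃ a, h2 = 1 - a := ⟨1 - h2, by ring⟩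
  have ha : I ≤ a := by linarith
  have hD : 0 < 2 * (2 + a + h1) := by linarith
  set ε := I / (2 * (2 + a + h1)) with hε
  have hε0 : 0 < ε := by positivity
  have hεI : ε * (2 * (2 + a + h1)) = I := div_mul_cancel₀ _ hD.ne'
  have hεa : 0 < ε * a := by apply mul_pos hε0; linarith
  have hεh : 0 < ε * h1 := by apply mul_pos hε0; linarith
  have hε2 : 0 < ε * (ε * h1) := mul_pos hε0 hεh
  have hε1 : ε < 1 := by rw [hε, div_lt_one hD]; linarith
  refine ⟨ε * h1 / 4, 1 - ε, (1 - ε) * (a - ε * h1 / 4) - ε, by positivity, by linarith,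
    by linarith, ?_, ?_, ?_, ?_⟩ <;> nlinarith

lemma tendsto_two_rpow_mul {x : ℝ} (hx : x < 0) :
    Filter.Tendsto (fun N : ℕ => (2 : ℝ) ^ ((N : ℝ) * x)) Filter.atTop (nhds 0) := by
  have h : ∀ N : ℕ, (2 : ℝ) ^ ((N : ℝ) * x) = ((2 : ℝ) ^ x) ^ N := fun N => by
    rw [mul_comm, Real.rpow_mul zero_le_two, Real.rpow_natCast]
  simp only [h]
  exact tendsto_pow_atTop_nhds_zero_of_lt_one (by positivity)
    (Real.rpow_lt_one_of_one_lt_of_neg one_lt_two hx)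

lemma msgCard_le_two_pow {n k : ℕ} {R : ℝ} (h : n * R ≤ k) : msgCard n R ≤ 2 ^ k := by
  refine Nat.floor_le_of_le ?_
  push_cast
  rw [← Real.rpow_natCast]
  exact Real.rpow_le_rpow_of_exponent_le one_le_two h

/-- Blocks of total rate `σ`, up to `c` letters lost by rounding, carry the rate `B σ / (B + 2)`. -/
lemma eventually_rate_le (B : ℕ) {σ : ℝ} (hσ : 0 < σ) (c : ℝ) :
    ∀ᶠ N : ℕ in Filter.atTop, ∀ n : ℕ, n / (B + 1) = N → ∀ k : ℝ, N * σ - c ≤ k →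
      n * (B / (B + 2) * σ) ≤ B * k := by
  have hlim := (tendsto_natCast_atTop_atTop (R := ℝ)).atTop_mul_const hσ
  filter_upwards [hlim.eventually_ge_atTop ((B + 1) * σ + (B + 2) * c)] with N hN n hn k hk
  have h1 : n < (N + 1) * (B + 1) := by
    rw [← hn]
    exact (Nat.div_lt_iff_lt_mul (Nat.succ_pos B)).1 (Nat.lt_succ_self _)
  have h2 : (n : ℝ) ≤ (N + 1) * (B + 1) := by exact_mod_cast h1.le
  have hB : (0 : ℝ) < B + 2 := by positivity
  have h3 : (n : ℝ) * σ ≤ (B + 2) * k := by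
    have := mul_le_mul_of_nonneg_right h2 hσ.le
    have := mul_le_mul_of_nonneg_left hk hB.le
    nlinarith
  calc (n : ℝ) * (B / (B + 2) * σ) = B * (n * σ / (B + 2)) := by ring
    _ ≤ B * k := by
      gcongr
      rw [div_le_iff₀ hB]
      linarith

/-- Noiseless feedback achieves a sum rate above the no-feedback bound. -/
lemma exists_achievableFB {p : Bool × Bool × Bool → ℝ} (hp : IsPMF p)
    (h1 : entOf p (fun z => (z.1, z.2.1)) ≤ 1) (h2 : entOf p (fun z => (z.1, z.2.2)) ≤ 1)
    (hnm : ¬ MarkovChain p (fun z => z.2.1) (fun z => z.1) (fun z => z.2.2)) :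
    ∃ R1 R2 : ℝ, 3 - crossEnt (markovLaw p) (markovLaw p) < R1 + R2 ∧
      AchievableFB (noiselessExt (dueckW p)) 0 R1 R2 := by
  obtain ⟨I, hI, hHt, hh0, hh01, hIh1, hh2⟩ := exists_entropy_gap hp h1 h2 hnm
  rw [hHt]
  obtain ⟨δ, l, r2, hδ, hl, hl1, hr2, hA, hC, hsum⟩ :=
    exists_block_parameters (h0 := crossEnt p fun z => mar0 p z.1) hI hIh1 hh2
  obtain ⟨ρ, hρ0, hρ1, hcode⟩ := exists_code_le hp hδ
  generalize crossEnt p (fun z => mar0 p z.1) = e0 at *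
  generalize crossEnt p (fun z => ker1 p z.1 z.2.1) = e1 at *
  generalize crossEnt p (fun z => ker2 p z.1 z.2.1 z.2.2) = e2 at *
  obtain ⟨r0, hr0⟩ : ∃ r0, r0 = 1 - e0 - e1 := ⟨_, rfl⟩
  rw [← hr0] at hA hsum
  have hr0' : 0 ≤ r0 := by linarith
  obtain ⟨b, hb⟩ : ∃ b, b = 1 - e2 - δ := ⟨_, rfl⟩
  rw [← hb] at hC
  have hb0 : 0 < b := by
    by_contra h
    nlinarith
  obtain ⟨B, hB⟩ : ∃ B : ℕ, 3 - (e0 + e1 + e2 + I) < B / (B + 2) * (l + r0 + r2) := by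
    have := (tendsto_natCast_div_add_atTop (2 : ℝ)).mul_const (l + r0 + r2)
    rw [one_mul] at this
    exact (this.eventually_const_lt hsum).exists
  have hN : Filter.Tendsto (fun n : ℕ => n / (B + 1)) Filter.atTop Filter.atTop :=
    Nat.tendsto_div_const_atTop (by omega)
  have hL : Filter.Tendsto (fun N : ℕ => ⌊(N : ℝ) * l⌋₊) Filter.atTop Filter.atTop :=
    tendsto_nat_floor_atTop.comp ((tendsto_natCast_atTop_atTop (R := ℝ)).atTop_mul_const hl)
  let β (N : ℕ) : ℝ := B * (ρ ^ N + ρ ^ ⌊(N : ℝ) * l⌋₊ + ρ ^ ⌊(N : ℝ) * l⌋₊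
    + (2 : ℝ) ^ ((N : ℝ) * (r0 + l * (e1 + δ) + (e0 + δ) - 1))
    + (2 : ℝ) ^ ((N : ℝ) * (r2 - l * b)) * (2 : ℝ) ^ b)
  have hβ : Filter.Tendsto β Filter.atTop (nhds 0) := by
    have t0 := tendsto_pow_atTop_nhds_zero_of_lt_one hρ0 hρ1
    have t1 := t0.comp hL
    have t2 := tendsto_two_rpow_mul (x := r0 + l * (e1 + δ) + (e0 + δ) - 1) (by linarith)
    have t3 := (tendsto_two_rpow_mul (x := r2 - l * b) (by linarith)).mul_const ((2 : ℝ) ^ b)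
    simpa using ((((t0.add t1).add t1).add t2).add t3).const_mul (B : ℝ)
  refine ⟨B / (B + 2) * (l + r0), B / (B + 2) * r2, by linarith, ?_⟩
  have hR1 : (0 : ℝ) ≤ B / (B + 2) * (l + r0) := by positivity
  have hR2 : (0 : ℝ) ≤ B / (B + 2) * r2 := by positivity
  refine achievableFB_of_eventually (noiselessExt_dueckW_nonneg hp) le_rfl hR1 hR2
    (hβ.comp hN) ?_
  filter_upwards [hN.eventually (eventually_rate_le B (σ := l + r0) (by linarith) 2),
    hN.eventually (eventually_rate_le B hr2 1)] with n hn1 hn2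
  simp only [Function.comp_apply]
  have hNn : (B + 1) * (n / (B + 1)) ≤ n := Nat.mul_div_le n (B + 1)
  generalize hNdef : n / (B + 1) = N at *
  have hLN : ⌊(N : ℝ) * l⌋₊ ≤ N := Nat.floor_le_of_le (mul_le_of_le_one_right (by positivity) hl1)
  have fL := Nat.floor_le (a := (N : ℝ) * l) (by positivity)
  have fL' := Nat.lt_floor_add_one ((N : ℝ) * l)
  have f0 := Nat.floor_le (a := (N : ℝ) * r0) (by positivity)
  have f0' := Nat.lt_floor_add_one ((N : ℝ) * r0)
  have f2 := Nat.floor_le (a := (N : ℝ) * r2) (by positivity)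
  have f2' := Nat.lt_floor_add_one ((N : ℝ) * r2)
  have hM1 := hn1 n hNdef ((⌊(N : ℝ) * r0⌋₊ + ⌊(N : ℝ) * l⌋₊ : ℕ) : ℝ)
    (by push_cast; linarith)
  have hM2 := hn2 n hNdef (⌊(N : ℝ) * r2⌋₊ : ℝ) (by linarith)
  obtain ⟨enc, dec1, dec2, hc, herr⟩ := hcode hR1 hR2 hLN hNn
    (msgCard_le_two_pow (by exact_mod_cast hM1)) (msgCard_le_two_pow (by exact_mod_cast hM2))
  refine ⟨enc, dec1, dec2, hc, herr.trans ?_⟩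
  simp only [β]
  generalize ⌊(N : ℝ) * l⌋₊ = L at *
  generalize ⌊(N : ℝ) * r0⌋₊ = k0 at *
  generalize ⌊(N : ℝ) * r2⌋₊ = k2 at *
  refine mul_le_mul_of_nonneg_left (add_le_add (add_le_add le_rfl ?_) ?_) (Nat.cast_nonneg _)
  · rw [← Real.rpow_natCast, ← Real.rpow_natCast, ← Real.rpow_add two_pos,
      ← Real.rpow_add two_pos, ← Real.rpow_sub two_pos]
    refine Real.rpow_le_rpow_of_exponent_le one_le_two ?_
    have := mul_le_mul_of_nonneg_right fL (show 0 ≤ e1 + δ by linarith)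
    linarith
  · rw [← Real.rpow_natCast, ← Real.rpow_natCast, ← Real.rpow_add two_pos,
      ← Real.rpow_sub two_pos, ← Real.rpow_add two_pos]
    refine Real.rpow_le_rpow_of_exponent_le one_le_two ?_
    have := mul_le_mul_of_nonneg_right fL'.le hb0.le
    have : (L : ℝ) * (e2 + δ) = L - L * b := by rw [hb]; ring
    linarith

/-- **Corollary 2.** If `Z₁ — Z₀ — Z₂` is not a Markov chain, then noiseless feedback
strictly increases the capacity region of the generalized Dueck DMBC. -/
theorem dueck_noiselessFB_strict (PZ : Bool × Bool × Bool → ℝ) (hPZ : IsPMF PZ)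
    (h1 : entOf PZ (fun z => (z.1, z.2.1)) ≤ 1)
    (h2 : entOf PZ (fun z => (z.1, z.2.2)) ≤ 1)
    (hnm : ¬ MarkovChain PZ (fun z => z.2.1) (fun z => z.1) (fun z => z.2.2)) :
    CNoFB (dueckW PZ) ⊂ CNoiselessFB (dueckW PZ) ∧
      ∃ R1 R2 : ℝ, (0, R1, R2) ∈ CNoiselessFB (dueckW PZ) ∧
        (0, R1, R2) ∉ CNoFB (dueckW PZ) := by
  obtain ⟨R1, R2, hsum, hach⟩ := exists_achievableFB hPZ h1 h2 hnm
  have hmem : (0, R1, R2) ∈ CNoiselessFB (dueckW PZ) := subset_closure hach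
  have hnot : (0, R1, R2) ∉ CNoFB (dueckW PZ) := fun h => by
    have := sum_rate_le_of_mem_CNoFB hPZ h
    simp only at this
    linarith
  exact ⟨⟨CNoFB_subset_CNoiselessFB _, fun h => hnot (h hmem)⟩, R1, R2, hmem, hnot⟩

end BCFB
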